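/- Let a, c be real numbers with −1 < a < 1, a ≠ 0, c ∉ {0,−1,−2,…}, and let 𝓕 = (F_1,F_2) be a pair of finite sets of positive integers, not both empty, such that Ω_𝓕^{a,c}(n) ≠ 0 for every n ∈ ℕ. Set w(x) = a^x·Γ(x+c+k)/(x!·Ω_𝓕^{a,c}(x)·Ω_𝓕^{a,c}(x+1)) for x ∈ ℕ. Then: (i) for all n, m ∈ σ_𝓕 with n ≠ m, the series ∑_{x=0}^∞ m_n^{a,c;𝓕}(x)·m_m^{a,c;𝓕}(x)·w(x) converges absolutely and its sum equals 0; (ii) if −1 < a < 0, then there exists x ∈ ℕ with w(x) < 0; (iii) if 0 < a < 1, then w(x) > 0 for every x ∈ ℕ if and only if c and 𝓕 are admissible. -/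

import Mathlib

open Finset MeasureTheory Polynomial

/-- Generalized binomial coefficient `C(t, j) = t(t-1)⋯(t-j+1)/j!`. -/
noncomputable def gbinom (t : ℝ) (j : ℕ) : ℝ :=
  (∏ i ∈ Finset.range j, (t - i)) / (Nat.factorial j)

/-- Pochhammer symbol `(t)_m = t(t+1)⋯(t+m-1)`. -/
noncomputable def poch (t : ℝ) (m : ℕ) : ℝ := ∏ i ∈ Finset.range m, (t + i)

/-- Pochhammer symbol with integer index (Γ-quotient convention for negative index). -/
noncomputable def pochZ (t : ℝ) (m : ℤ) : ℝ :=
  if 0 ≤ m then ∏ i ∈ Finset.range m.toNat, (t + i)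
  else (∏ i ∈ Finset.range (-m).toNat, (t - (i + 1)))⁻¹

/-- `ĉ = max(-⌊c⌋, 0)`. -/
noncomputable def chat (c : ℝ) : ℕ := (-⌊c⌋).toNat

/-- Admissibility of `c` and the pair `𝓕 = (F₁, F₂)`. -/
def IsAdmissible (c : ℝ) (F1 F2 : Finset ℕ) : Prop :=
  ∀ x : ℕ, 0 ≤ (∏ f ∈ F1, ((x : ℝ) - f)) * (∏ f ∈ F2, ((x : ℝ) + c + f)) /
    poch ((x : ℝ) + c) (chat c)

/-- `u_𝓕 = ∑_{f∈F₁} f + ∑_{f∈F₂} f - C(k₁+1, 2) - C(k₂, 2)`. -/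
def uF (F1 F2 : Finset ℕ) : ℕ :=
  (∑ f ∈ F1, f + ∑ f ∈ F2, f) - (Nat.choose (F1.card + 1) 2 + Nat.choose F2.card 2)

/-- `σ_𝓕 = {u_𝓕, u_𝓕+1, …} \ {u_𝓕 + f : f ∈ F₁}`. -/
def sigmaF (F1 F2 : Finset ℕ) : Set ℕ :=
  {n | uF F1 F2 ≤ n ∧ ∀ f ∈ F1, n ≠ uF F1 F2 + f}

/-- The `i`-th element (0-based) of `F` in increasing order. -/
def nth (F : Finset ℕ) (i : ℕ) : ℕ := (F.sort (· ≤ ·)).getD i 0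
/-- The Meixner polynomial `m_n^{a,c}` evaluated at `x`. -/
noncomputable def meixner (a c : ℝ) (n : ℕ) (x : ℝ) : ℝ :=
  (a / (1 - a)) ^ n *
    ∑ j ∈ Finset.range (n + 1), a ^ (-(j : ℤ)) * gbinom x j * gbinom (-x - c) (n - j)

/-- The polynomial `m_n^{a,c;𝓕}` (Casorati determinant of Meixner polynomials). -/
noncomputable def mExc (a c : ℝ) (F1 F2 : Finset ℕ) (n : ℕ) (x : ℝ) : ℝ :=
  Matrix.det (Matrix.of fun i j : Fin (F1.card + F2.card + 1) =>
    if (i : ℕ) = 0 then meixner a c (n - uF F1 F2) (x + ((j : ℕ) : ℝ))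
    else if (i : ℕ) - 1 < F1.card then meixner a c (nth F1 ((i : ℕ) - 1)) (x + ((j : ℕ) : ℝ))
    else a ^ (-((j : ℕ) : ℤ)) *
      meixner a⁻¹ c (nth F2 ((i : ℕ) - 1 - F1.card)) (x + ((j : ℕ) : ℝ)))

/-- The Casorati determinant `Ω_𝓕^{a,c}(x)`. -/
noncomputable def OmegaM (a c : ℝ) (F1 F2 : Finset ℕ) (x : ℝ) : ℝ :=
  Matrix.det (Matrix.of fun i j : Fin (F1.card + F2.card) =>
    if (i : ℕ) < F1.card then meixner a c (nth F1 (i : ℕ)) (x + ((j : ℕ) : ℝ))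
    else a ^ (-((j : ℕ) : ℤ)) *
      meixner a⁻¹ c (nth F2 ((i : ℕ) - F1.card)) (x + ((j : ℕ) : ℝ)))

/-- The determinant `Λ_𝓕^{a,c}(x)` (columns `0, …, k-2, k`). -/
noncomputable def LambdaM (a c : ℝ) (F1 F2 : Finset ℕ) (x : ℝ) : ℝ :=
  Matrix.det (Matrix.of fun i j : Fin (F1.card + F2.card) =>
    let col : ℕ := if (j : ℕ) = F1.card + F2.card - 1 then F1.card + F2.card else (j : ℕ)
    if (i : ℕ) < F1.card then meixner a c (nth F1 (i : ℕ)) (x + (col : ℝ))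
    else a ^ (-(col : ℤ)) *
      meixner a⁻¹ c (nth F2 ((i : ℕ) - F1.card)) (x + (col : ℝ)))
/-- The polynomial `q_n^𝓕` (Christoffel-transform dual of `m_n^{a,c;𝓕}`). -/
noncomputable def qExc (a c : ℝ) (F1 F2 : Finset ℕ) (n : ℕ) (x : ℝ) : ℝ :=
  Matrix.det (Matrix.of fun i j : Fin (F1.card + F2.card + 1) =>
    if (i : ℕ) = 0 then meixner a c (n + (j : ℕ)) (x - (uF F1 F2 : ℝ))
    else if (i : ℕ) - 1 < F1.card then
      meixner a c (n + (j : ℕ)) ((nth F1 ((i : ℕ) - 1) : ℝ))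
    else (-1 : ℝ) ^ (j : ℕ) *
      meixner a⁻¹ c (n + (j : ℕ)) ((nth F2 ((i : ℕ) - 1 - F1.card) : ℝ))) /
  ((-1 : ℝ) ^ (n * F2.card) * (∏ f ∈ F1, (x - (f : ℝ) - (uF F1 F2 : ℝ))) *
    ∏ f ∈ F2, (x + c + (f : ℝ) - (uF F1 F2 : ℝ)))

/-- The second order difference operator `D_𝓕` of Theorem 3.3. -/
noncomputable def DopM (a c : ℝ) (F1 F2 : Finset ℕ) (g : ℝ → ℝ) (x : ℝ) : ℝ :=
  (x * OmegaM a c F1 F2 (x + 1) / ((a - 1) * OmegaM a c F1 F2 x)) * g (x - 1)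
  + (-((1 + a) * (x + ((F1.card + F2.card : ℕ) : ℝ)) + a * c) / (a - 1) + (uF F1 F2 : ℝ)
      + a * (x + c + ((F1.card + F2.card : ℕ) : ℝ)) * LambdaM a c F1 F2 (x + 1) /
          ((a - 1) * OmegaM a c F1 F2 (x + 1))
      - a * (x + c + ((F1.card + F2.card : ℕ) : ℝ) - 1) * LambdaM a c F1 F2 x /
          ((a - 1) * OmegaM a c F1 F2 x)) * g x
  + (a * (x + c + ((F1.card + F2.card : ℕ) : ℝ)) * OmegaM a c F1 F2 x /
      ((a - 1) * OmegaM a c F1 F2 (x + 1))) * g (x + 1)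

/-- The weight `w(x) = aˣ Γ(x+c+k)/(x! Ω(x) Ω(x+1))` on `ℕ`. -/
noncomputable def wM (a c : ℝ) (F1 F2 : Finset ℕ) (x : ℕ) : ℝ :=
  a ^ x * Real.Gamma ((x : ℝ) + c + ((F1.card + F2.card : ℕ) : ℝ)) /
    ((Nat.factorial x : ℝ) * OmegaM a c F1 F2 (x : ℝ) * OmegaM a c F1 F2 ((x : ℝ) + 1))
/-! ### Part 1: Meixner polynomials -/

lemma gbinom_eq_choose (t : ℝ) (j : ℕ) : gbinom t j = Ring.choose t j := by
  have h := Ring.descPochhammer_eq_factorial_smul_choose t j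
  have h2 : (descPochhammer ℤ j).smeval t = ∏ i ∈ Finset.range j, (t - i) := by
    rw [← descPochhammer_eval_eq_prod_range, ← descPochhammer_map (Int.castRingHom ℝ),
      Polynomial.eval_map, Polynomial.eval₂_eq_sum, Polynomial.smeval_eq_sum]
    refine Finset.sum_congr rfl fun i _ => ?_
    simp [Polynomial.smul_pow]
  rw [gbinom, ← h2, h, nsmul_eq_mul]
  field_simp

/-- Falling factorial. -/
noncomputable def ffac (x : ℝ) (j : ℕ) : ℝ := ∏ i ∈ Finset.range j, (x - i)

/-- Normalized Meixner polynomial. -/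
noncomputable def MN (a c : ℝ) (n : ℕ) (x : ℝ) : ℝ :=
  ∑ j ∈ Finset.range (n + 1), (n.choose j : ℝ) * ((1 - a⁻¹) ^ j / poch c j) * ffac x j

noncomputable def gam (a c : ℝ) (n : ℕ) : ℝ := (a / (a - 1)) ^ n * poch c n / (n.factorial : ℝ)

lemma poch_ne (c : ℝ) (hc : ∀ n : ℕ, c ≠ -(n : ℝ)) (n : ℕ) : poch c n ≠ 0 := by
  rw [poch, Finset.prod_ne_zero_iff]
  intro i _ h
  exact hc i (by linarith)

lemma poch_add (c : ℝ) (m n : ℕ) : poch c (m + n) = poch c m * poch (c + m) n := by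
  simp only [poch, Finset.prod_range_add]
  congr 1
  refine Finset.prod_congr rfl fun i _ => ?_
  push_cast; ring

lemma poch_succ (c : ℝ) (n : ℕ) : poch c (n + 1) = poch c n * (c + n) := by
  simp [poch, Finset.prod_range_succ]

lemma gam_ne (a c : ℝ) (ha0 : a ≠ 0) (ha1 : a ≠ 1) (hc : ∀ n : ℕ, c ≠ -(n : ℝ)) (n : ℕ) :
    gam a c n ≠ 0 := by
  have h1 : a - 1 ≠ 0 := sub_ne_zero.mpr ha1
  have h2 := poch_ne c hc n
  unfold gam
  positivity

lemma ffac_neg (c : ℝ) (m : ℕ) : ffac (-c) m = (-1) ^ m * poch c m := by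
  simp only [ffac, poch]
  rw [← Finset.card_range m, ← Finset.prod_const, Finset.card_range, ← Finset.prod_mul_distrib]
  refine Finset.prod_congr rfl fun i _ => ?_
  ring

lemma meixner_sum (a c : ℝ) (n : ℕ) (x : ℝ) :
    ∑ j ∈ Finset.range (n + 1), a ^ (-(j : ℤ)) * gbinom x j * gbinom (-x - c) (n - j) =
    ∑ i ∈ Finset.range (n + 1), (a⁻¹ - 1) ^ i * gbinom x i * gbinom (-c - i) (n - i) := by
  have hl : ∀ j ∈ Finset.range (n + 1), a ^ (-(j : ℤ)) * gbinom x j * gbinom (-x - c) (n - j) =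
      ∑ i ∈ Finset.range (j + 1), (a⁻¹ - 1) ^ i * gbinom x i *
        (gbinom (x - i) (j - i) * gbinom (-x - c) (n - j)) := by
    intro j _
    have h1 : a ^ (-(j : ℤ)) = ∑ i ∈ Finset.range (j + 1), (a⁻¹ - 1) ^ i * (j.choose i : ℝ) := by
      have := add_pow (a⁻¹ - 1) 1 j
      simp only [sub_add_cancel, one_pow, mul_one] at this
      rw [← this]; simp
    rw [h1, Finset.sum_mul, Finset.sum_mul]
    refine Finset.sum_congr rfl fun i hi => ?_
    have hij : i ≤ j := by simpa [Nat.lt_succ_iff] using hi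
    have h2 := Ring.choose_smul_choose x hij
    rw [nsmul_eq_mul] at h2
    simp only [gbinom_eq_choose]
    linear_combination (a⁻¹ - 1) ^ i * Ring.choose (-x - c) (n - j) * h2
  rw [Finset.sum_congr rfl hl]
  rw [Finset.sum_comm' (s' := fun i => Finset.Ico i (n + 1)) (t' := Finset.range (n + 1))]
  · refine Finset.sum_congr rfl fun i hi => ?_
    have hin : i ≤ n := by simpa [Nat.lt_succ_iff] using hi
    rw [← Finset.mul_sum]
    congr 1
    rw [Finset.sum_Ico_eq_sum_range]
    have h3 := Ring.add_choose_eq (n - i) (Commute.all (x - i) (-x - c))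
    rw [Finset.Nat.sum_antidiagonal_eq_sum_range_succ_mk] at h3
    simp only [gbinom_eq_choose]
    rw [show -c - (i : ℝ) = x - i + (-x - c) by ring, h3]
    rw [show n + 1 - i = (n - i).succ by omega]
    refine Finset.sum_congr rfl fun l hl => ?_
    rw [show i + l - i = l by omega, show n - (i + l) = n - i - l by omega]
  · intro j i
    simp only [Finset.mem_range, Finset.mem_Ico]
    omega

lemma meixner_eq (a c : ℝ) (ha0 : a ≠ 0) (ha1 : a ≠ 1) (hc : ∀ n : ℕ, c ≠ -(n : ℝ))
    (n : ℕ) (x : ℝ) : meixner a c n x = gam a c n * MN a c n x := by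
  have h1 : a - 1 ≠ 0 := sub_ne_zero.mpr ha1
  have h1' : 1 - a ≠ 0 := sub_ne_zero.mpr ha1.symm
  rw [meixner, meixner_sum, MN, gam, Finset.mul_sum, Finset.mul_sum]
  refine Finset.sum_congr rfl fun i hi => ?_
  have hin : i ≤ n := by simpa [Nat.lt_succ_iff] using hi
  obtain ⟨m, rfl⟩ := Nat.exists_eq_add_of_le hin
  rw [show i + m - i = m by omega]
  have e1 : gbinom (-c - i) m = (-1) ^ m * poch (c + i) m / (m.factorial : ℝ) := by
    rw [gbinom, ← ffac_neg, ffac]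
    congr 1
    refine Finset.prod_congr rfl fun i _ => ?_
    ring
  rw [e1, show gbinom x i = ffac x i / (i.factorial : ℝ) from rfl, poch_add]
  have e2 : ((i + m).choose i : ℝ) = ((i + m).factorial : ℝ) / (i.factorial * m.factorial) := by
    rw [Nat.cast_add_choose]
  have e3 : (a / (1 - a)) = (-1) * (a / (a - 1)) := by
    field_simp; ring
  have e4 : a⁻¹ - 1 = (-1) * (1 - a⁻¹) := by ring
  rw [e2, e3, e4, mul_pow, mul_pow]
  have := poch_ne c hc i
  have s : ((-1 : ℝ) ^ i) * (-1) ^ i = 1 := by rw [← mul_pow]; simp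
  have s' : ((-1 : ℝ) ^ m) * (-1) ^ m = 1 := by rw [← mul_pow]; simp
  have s2 : ((-1 : ℝ)) ^ (i + m) * (-1) ^ i * (-1) ^ m = 1 := by
    rw [pow_add]; linear_combination ((-1 : ℝ) ^ m) * (-1) ^ m * s + s'
  have hf : ((i + m).factorial : ℝ) ≠ 0 := by positivity
  field_simp
  linear_combination ffac x i * poch (c + i) m * s2

lemma ffac_nat (x j : ℕ) : ffac (x : ℝ) j = (x.descFactorial j : ℝ) := by
  rw [ffac, ← descPochhammer_eval_eq_prod_range, descPochhammer_eval_eq_descFactorial]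

lemma MN_symm (a c : ℝ) (n x : ℕ) : MN a c n (x : ℝ) = MN a c x (n : ℝ) := by
  have key : ∀ n x : ℕ, MN a c n (x : ℝ) = ∑ j ∈ Finset.range (n + x + 1),
      ((1 - a⁻¹) ^ j / poch c j) * ((n.choose j : ℝ) * (x.choose j : ℝ) * (j.factorial : ℝ)) := by
    intro n x
    rw [MN]
    rw [← Finset.sum_subset (s₁ := Finset.range (n + 1)) (s₂ := Finset.range (n + x + 1))]
    · refine Finset.sum_congr rfl fun j _ => ?_
      rw [ffac_nat, Nat.descFactorial_eq_factorial_mul_choose]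
      push_cast; ring
    · intro j; simp only [Finset.mem_range]; omega
    · intro j _ hj
      simp only [Finset.mem_range] at hj
      rw [Nat.choose_eq_zero_of_lt (by omega)]; simp
  rw [key, key, add_comm n x]
  refine Finset.sum_congr rfl fun j _ => ?_
  ring

lemma meixner_refl (a c : ℝ) (ha0 : a ≠ 0) (ha1 : a ≠ 1) (n : ℕ) (x : ℝ) :
    meixner a c n (-x - c) = (-1) ^ n * meixner a⁻¹ c n x := by
  have h1 : a - 1 ≠ 0 := sub_ne_zero.mpr ha1
  have h1' : 1 - a ≠ 0 := sub_ne_zero.mpr ha1.symm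
  rw [meixner, meixner, ← Finset.sum_range_reflect, ← mul_assoc, ← mul_pow]
  have e : (-1 : ℝ) * (a⁻¹ / (1 - a⁻¹)) = (a / (1 - a)) * a⁻¹ := by
    have : 1 - a⁻¹ ≠ 0 := by
      intro h; apply h1; field_simp at h; simpa using h
    field_simp
    ring
  rw [e, mul_pow, mul_assoc]
  congr 1
  rw [Finset.mul_sum]
  refine Finset.sum_congr rfl fun j hj => ?_
  have hj' : j ≤ n := by simpa [Nat.lt_succ_iff] using hj
  rw [show n + 1 - 1 - j = n - j by omega, show n - (n - j) = j by omega]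
  rw [show - (-x - c) - c = x by ring]
  have : a ^ (-((n - j : ℕ) : ℤ)) = a⁻¹ ^ n * a⁻¹ ^ (-(j : ℤ)) := by
    rw [Nat.cast_sub hj', ← zpow_natCast, ← zpow_add₀ (inv_ne_zero ha0), inv_zpow', ]
    congr 1
  rw [this]; ring

lemma inv_ne_one' {a : ℝ} (ha1 : a ≠ 1) : a⁻¹ ≠ 1 := by
  simpa using ha1

lemma meixner_inv_dual (a c : ℝ) (ha0 : a ≠ 0) (ha1 : a ≠ 1) (hc : ∀ n : ℕ, c ≠ -(n : ℝ))
    (f x : ℕ) : meixner a⁻¹ c f (x : ℝ) = gam a⁻¹ c f * (a ^ x * MN a c x (-c - f)) := by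
  have h0 : a⁻¹ ≠ 0 := inv_ne_zero ha0
  have h1 : a⁻¹ ≠ 1 := inv_ne_one' ha1
  have hm : a - 1 ≠ 0 := sub_ne_zero.mpr ha1
  have hm' : 1 - a ≠ 0 := sub_ne_zero.mpr ha1.symm
  rw [meixner_eq _ _ h0 h1 hc, MN_symm]
  congr 1
  have r := meixner_refl a c ha0 ha1 x (f : ℝ)
  rw [meixner_eq _ _ ha0 ha1 hc, meixner_eq _ _ h0 h1 hc] at r
  have g : (-1) ^ x * gam a⁻¹ c x * a ^ x = gam a c x := by
    simp only [gam]
    have e : (-1 : ℝ) * (a⁻¹ / (a⁻¹ - 1)) * a = a / (a - 1) := by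
      have : a⁻¹ - 1 ≠ 0 := sub_ne_zero.mpr h1
      field_simp
      ring
    rw [← e, mul_pow, mul_pow]; ring
  have hg := gam_ne a c ha0 ha1 hc x
  have hg' := gam_ne a⁻¹ c h0 h1 hc x
  have s : ((-1 : ℝ) ^ x) * (-1) ^ x = 1 := by rw [← mul_pow]; simp
  rw [show -c - (f : ℝ) = -f - c by ring]
  apply mul_left_cancel₀ hg'
  apply mul_left_cancel₀ (pow_ne_zero x (by norm_num : (-1 : ℝ) ≠ 0))
  rw [← mul_assoc, ← mul_assoc] at *
  linear_combination -r - g * MN a c x (-f - c)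

lemma ffac_succ (x : ℝ) (j : ℕ) : ffac x (j + 1) = ffac x j * (x - j) := by
  simp [ffac, Finset.prod_range_succ]

lemma ffac_succ' (x : ℝ) (j : ℕ) : ffac x (j + 1) = x * ffac (x - 1) j := by
  rw [ffac, Finset.prod_range_succ', mul_comm]
  simp only [ffac, Nat.cast_zero, sub_zero]
  congr 1
  refine Finset.prod_congr rfl fun i _ => ?_
  push_cast; ring

lemma ffac_diff (a c x : ℝ) (j : ℕ) :
    a * (x + c) * ffac (x + 1) j - (x + a * (x + c)) * ffac x j + x * ffac (x - 1) j =
    (a - 1) * j * ffac x j + a * j * (c + j - 1) * ffac x (j - 1) := by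
  cases j with
  | zero => simp [ffac]
  | succ j =>
    have e1 := ffac_succ' (x + 1) j
    rw [add_sub_cancel_right] at e1
    have e2 := ffac_succ x j
    have e3 : x * ffac (x - 1) (j + 1) = ffac x j * (x - j) * (x - (j + 1)) := by
      rw [← ffac_succ', ffac_succ, ffac_succ]; push_cast; ring
    rw [e3, e1, e2]
    push_cast
    ring

lemma MN_diff (a c : ℝ) (ha0 : a ≠ 0) (hc : ∀ n : ℕ, c ≠ -(n : ℝ)) (n : ℕ) (x : ℝ) :
    a * (x + c) * MN a c n (x + 1) - (x + a * (x + c)) * MN a c n x + x * MN a c n (x - 1) =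
      (a - 1) * n * MN a c n x := by
  have h1 : a * (x + c) * MN a c n (x + 1) - (x + a * (x + c)) * MN a c n x
      + x * MN a c n (x - 1) = ∑ j ∈ Finset.range (n + 1), (n.choose j : ℝ) *
        ((1 - a⁻¹) ^ j / poch c j) *
        ((a - 1) * j * ffac x j + a * j * (c + j - 1) * ffac x (j - 1)) := by
    simp only [← ffac_diff, MN, Finset.mul_sum, ← Finset.sum_sub_distrib, ← Finset.sum_add_distrib]
    refine Finset.sum_congr rfl fun j _ => ?_
    ring
  rw [h1]
  simp only [mul_add, Finset.sum_add_distrib]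
  have h2 : ∑ j ∈ Finset.range (n + 1), (n.choose j : ℝ) *
        ((1 - a⁻¹) ^ j / poch c j) * (a * j * (c + j - 1) * ffac x (j - 1)) =
      ∑ j ∈ Finset.range (n + 1), (n.choose j : ℝ) *
        ((1 - a⁻¹) ^ j / poch c j) * ((a - 1) * (n - j) * ffac x j) := by
    rw [Finset.sum_range_succ', Finset.sum_range_succ]
    simp only [Nat.cast_zero, mul_zero, zero_mul, add_zero, sub_self]
    refine Finset.sum_congr rfl fun j hj => ?_
    have hj' : j < n := by simpa using hj
    have e := Nat.choose_succ_right_eq n j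
    have e' : (n.choose (j + 1) : ℝ) * (j + 1) = n.choose j * (n - j) := by
      have : ((n.choose (j + 1) * (j + 1) : ℕ) : ℝ) = ((n.choose j * (n - j) : ℕ) : ℝ) := by
        rw [e]
      rw [Nat.cast_mul, Nat.cast_mul, Nat.cast_sub hj'.le] at this
      exact_mod_cast this
    rw [poch_succ, Nat.add_sub_cancel]
    have p1 := poch_ne c hc j
    have p2 : c + j ≠ 0 := fun h => hc j (by linarith)
    have e5 : (n.choose (j + 1) : ℝ) * ((1 - a⁻¹) ^ (j + 1) / (poch c j * (c + j))) *
        (a * ((j + 1 : ℕ) : ℝ) * (c + ((j + 1 : ℕ) : ℝ) - 1) * ffac x j)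
        = (n.choose (j + 1) * (j + 1)) * ((1 - a⁻¹) ^ j * (a - 1) / poch c j) * ffac x j := by
      push_cast
      rw [pow_succ]
      field_simp
      ring
    rw [e5, e']; ring
  rw [h2, ← Finset.sum_add_distrib, MN, Finset.mul_sum]
  refine Finset.sum_congr rfl fun j _ => ?_
  ring

lemma meixner_diff (a c : ℝ) (ha0 : a ≠ 0) (ha1 : a ≠ 1) (hc : ∀ n : ℕ, c ≠ -(n : ℝ))
    (n : ℕ) (x : ℝ) :
    a * (x + c) * meixner a c n (x + 1) - (x + a * (x + c)) * meixner a c n x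
      + x * meixner a c n (x - 1) = (a - 1) * n * meixner a c n x := by
  simp only [meixner_eq a c ha0 ha1 hc]
  linear_combination gam a c n * MN_diff a c ha0 hc n x


/-! ### Part 2: polynomially bounded sequences -/

/-- Polynomially bounded sequences. -/
def PB (f : ℕ → ℝ) : Prop := ∃ (C : ℝ) (M : ℕ), 0 ≤ C ∧ ∀ x : ℕ, |f x| ≤ C * ((x : ℝ) + 1) ^ M

lemma PB.mul {f g : ℕ → ℝ} (hf : PB f) (hg : PB g) : PB (fun x => f x * g x) := by
  obtain ⟨C, M, hC, h⟩ := hf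
  obtain ⟨C', M', hC', h'⟩ := hg
  refine ⟨C * C', M + M', by positivity, fun x => ?_⟩
  rw [abs_mul]
  calc |f x| * |g x| ≤ (C * ((x : ℝ) + 1) ^ M) * (C' * ((x : ℝ) + 1) ^ M') :=
        mul_le_mul (h x) (h' x) (abs_nonneg _) (by positivity)
    _ = _ := by rw [pow_add]; ring

lemma PB.add {f g : ℕ → ℝ} (hf : PB f) (hg : PB g) : PB (fun x => f x + g x) := by
  obtain ⟨C, M, hC, h⟩ := hf
  obtain ⟨C', M', hC', h'⟩ := hg
  refine ⟨C + C', M + M', by positivity, fun x => ?_⟩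
  have h1 : (1 : ℝ) ≤ (x : ℝ) + 1 := by have := Nat.cast_nonneg (α := ℝ) x; linarith
  have e1 : ((x : ℝ) + 1) ^ M ≤ ((x : ℝ) + 1) ^ (M + M') := pow_le_pow_right₀ h1 (by omega)
  have e2 : ((x : ℝ) + 1) ^ M' ≤ ((x : ℝ) + 1) ^ (M + M') := pow_le_pow_right₀ h1 (by omega)
  calc |f x + g x| ≤ |f x| + |g x| := abs_add_le _ _
    _ ≤ C * ((x : ℝ) + 1) ^ M + C' * ((x : ℝ) + 1) ^ M' := add_le_add (h x) (h' x)
    _ ≤ C * ((x : ℝ) + 1) ^ (M + M') + C' * ((x : ℝ) + 1) ^ (M + M') := by gcongr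
    _ = _ := by ring

lemma PB.of_le {f : ℕ → ℝ} (C : ℝ) (h : ∀ x, |f x| ≤ C) : PB f :=
  ⟨C, 0, le_trans (abs_nonneg _) (h 0), fun x => by simpa using h x⟩

lemma PB.const (r : ℝ) : PB (fun _ => r) := PB.of_le |r| (fun _ => le_rfl)

lemma PB.neg {f : ℕ → ℝ} (hf : PB f) : PB (fun x => - f x) := by
  simpa using (PB.const (-1)).mul hf

lemma PB.sub {f g : ℕ → ℝ} (hf : PB f) (hg : PB g) : PB (fun x => f x - g x) := by
  simpa [sub_eq_add_neg] using hf.add hg.neg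

lemma PB.abs {f : ℕ → ℝ} (hf : PB f) : PB (fun x => |f x|) := by
  obtain ⟨C, M, hC, h⟩ := hf
  exact ⟨C, M, hC, fun x => by simpa using h x⟩

lemma PB.cast : PB (fun x => (x : ℝ)) :=
  ⟨1, 1, zero_le_one, fun x => by
    have := Nat.cast_nonneg (α := ℝ) x
    rw [abs_of_nonneg this]; linarith⟩

lemma PB.poly (p : ℝ[X]) : PB (fun x => p.eval (x : ℝ)) := by
  induction p using Polynomial.induction_on' with
  | add p q hp hq => simpa using hp.add hq
  | monomial n r =>
    refine ⟨|r|, n, abs_nonneg _, fun x => ?_⟩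
    have := Nat.cast_nonneg (α := ℝ) x
    simp only [eval_monomial]
    rw [abs_mul, abs_pow, abs_of_nonneg this]
    gcongr
    linarith

lemma PB.summable {f : ℕ → ℝ} (hf : PB f) {a : ℝ} (ha0 : a ≠ 0) (ha : |a| < 1) :
    Summable (fun x : ℕ => |a ^ x * f x|) := by
  obtain ⟨C, M, hC, h⟩ := hf
  have s := summable_pow_mul_geometric_of_norm_lt_one (R := ℝ) M (r := |a|) (by simpa using ha)
  have s1 := ((summable_nat_add_iff 1).mpr s).mul_left (C * |a|⁻¹)
  refine Summable.of_nonneg_of_le (fun x => abs_nonneg _) (fun x => ?_) s1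
  have : |a| ≠ 0 := abs_ne_zero.mpr ha0
  rw [abs_mul, abs_pow]
  calc |a| ^ x * |f x| ≤ |a| ^ x * (C * ((x : ℝ) + 1) ^ M) := by gcongr; exact h x
    _ = _ := by push_cast; rw [pow_succ]; field_simp

lemma PB.summable' {f : ℕ → ℝ} (hf : PB f) {a : ℝ} (ha0 : a ≠ 0) (ha : |a| < 1) :
    Summable (fun x : ℕ => a ^ x * f x) := (hf.summable ha0 ha).of_abs

lemma PB.tendsto {f : ℕ → ℝ} (hf : PB f) {a : ℝ} (ha0 : a ≠ 0) (ha : |a| < 1) :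
    Filter.Tendsto (fun x : ℕ => a ^ x * f x) Filter.atTop (nhds 0) :=
  (hf.summable' ha0 ha).tendsto_atTop_zero

lemma PB.of_rec (r : ℕ → ℝ) (b : ℝ) (h : ∀ x : ℕ, r (x + 1) * (x + 1) = r x * (x + b)) : PB r := by
  obtain ⟨B, hB⟩ := exists_nat_ge |b|
  refine ⟨|r 0|, B, abs_nonneg _, fun x => ?_⟩
  induction x with
  | zero => simp
  | succ x ih =>
    have hx : (0 : ℝ) < (x : ℝ) + 1 := by positivity
    have h1 : |r (x + 1)| * (x + 1) = |r x| * |(x : ℝ) + b| := by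
      rw [← abs_mul, ← h, abs_mul, abs_of_pos hx]
    have h2 : |(x : ℝ) + b| ≤ x + 1 + B := by
      rw [abs_le]; have := abs_le.mp hB; constructor <;> linarith [this.1, this.2]
    have h3 : 1 + (B : ℝ) * (1 / (x + 1)) ≤ (1 + 1 / (x + 1)) ^ B :=
      one_add_mul_le_pow (by have : (0 : ℝ) ≤ 1 / (x + 1) := by positivity
                             linarith) B
    have h4 : |r (x + 1)| = |r x| * |(x : ℝ) + b| / (x + 1) := by
      rw [← h1]; field_simp
    rw [h4]
    calc |r x| * |(x : ℝ) + b| / (x + 1) ≤ (|r 0| * ((x : ℝ) + 1) ^ B) * (x + 1 + B) / (x + 1) := by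
          gcongr
      _ = |r 0| * ((x : ℝ) + 1) ^ B * (1 + (B : ℝ) * (1 / (x + 1))) := by field_simp
      _ ≤ |r 0| * ((x : ℝ) + 1) ^ B * (1 + 1 / (x + 1)) ^ B := by gcongr
      _ = |r 0| * (((x + 1 : ℕ) : ℝ) + 1) ^ B := by
          rw [mul_assoc, ← mul_pow]; congr 2; push_cast; field_simp

lemma PB.gamma (b : ℝ) (hb : ∀ x : ℕ, (x : ℝ) + b ≠ 0) :
    PB (fun x => Real.Gamma ((x : ℝ) + b) / (x.factorial : ℝ)) := by
  refine PB.of_rec _ b fun x => ?_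
  rw [show (((x + 1 : ℕ) : ℝ) + b) = (x + b) + 1 by push_cast; ring, Real.Gamma_add_one (hb x),
    Nat.factorial_succ]
  push_cast
  field_simp

lemma PB.poch (c : ℝ) : PB (fun x => poch c x / (x.factorial : ℝ)) := by
  refine PB.of_rec _ c fun x => ?_
  rw [poch_succ, Nat.factorial_succ]
  push_cast
  field_simp
  ring

lemma poly_eventually (p : ℝ[X]) (hp : p ≠ 0) : ∃ ε > 0,
    (∀ᶠ x : ℝ in Filter.atTop, ε ≤ p.eval x) ∨ (∀ᶠ x : ℝ in Filter.atTop, p.eval x ≤ -ε) := by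
  by_cases hd : 0 < p.degree
  · refine ⟨1, one_pos, ?_⟩
    rcases le_total 0 p.leadingCoeff with h | h
    · exact Or.inl ((p.tendsto_atTop_of_leadingCoeff_nonneg hd h).eventually_ge_atTop 1)
    · exact Or.inr ((p.tendsto_atBot_of_leadingCoeff_nonpos hd h).eventually_le_atBot (-1))
  · have := Polynomial.eq_C_of_degree_le_zero (not_lt.mp hd)
    set r := p.coeff 0
    have hr : r ≠ 0 := by rintro h; rw [h] at this; simp at this; exact hp this
    refine ⟨|r|, abs_pos.mpr hr, ?_⟩
    rw [this]
    rcases lt_or_gt_of_ne hr with h | h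
    · right; simp [abs_of_neg h]
    · left; simp [abs_of_pos h]

lemma PB.inv_poly (p : ℝ[X]) (hp : ∀ n : ℕ, p.eval (n : ℝ) ≠ 0) :
    PB (fun x => (p.eval (x : ℝ))⁻¹) := by
  have hp0 : p ≠ 0 := by rintro rfl; exact hp 0 (by simp)
  obtain ⟨ε, hε, h⟩ := poly_eventually p hp0
  have h2 : ∀ᶠ x : ℝ in Filter.atTop, ε ≤ |p.eval x| := by
    rcases h with h | h
    · filter_upwards [h] with x hx using hx.trans (le_abs_self _)
    · filter_upwards [h] with x hx using (by linarith : ε ≤ - p.eval x).trans (neg_le_abs _)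
  have h3 := tendsto_natCast_atTop_atTop (R := ℝ).eventually h2
  obtain ⟨N, hN⟩ := Filter.eventually_atTop.mp h3
  refine PB.of_le (ε⁻¹ + ∑ n ∈ Finset.range N, |(p.eval (n : ℝ))⁻¹|) fun x => ?_
  by_cases hx : x < N
  · have := Finset.single_le_sum (f := fun n : ℕ => |(p.eval (n : ℝ))⁻¹|)
      (fun i _ => abs_nonneg _) (Finset.mem_range.mpr hx)
    have h5 : 0 < ε⁻¹ := by positivity
    linarith
  · have h4 := hN x (not_lt.mp hx)
    rw [abs_inv]
    have : |p.eval (x : ℝ)|⁻¹ ≤ ε⁻¹ := by gcongr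
    have h5 : 0 ≤ ∑ n ∈ Finset.range N, |(p.eval (n : ℝ))⁻¹| :=
      Finset.sum_nonneg fun i _ => abs_nonneg _
    linarith

lemma poly_consec (p : ℝ[X]) (hp : p ≠ 0) :
    ∀ᶠ n : ℕ in Filter.atTop, 0 < p.eval (n : ℝ) * p.eval ((n : ℝ) + 1) := by
  obtain ⟨ε, hε, h⟩ := poly_eventually p hp
  have ht := tendsto_natCast_atTop_atTop (R := ℝ)
  have ht1 : Filter.Tendsto (fun n : ℕ => (n : ℝ) + 1) Filter.atTop Filter.atTop :=
    Filter.tendsto_atTop_add_const_right _ _ ht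
  rcases h with h | h
  · filter_upwards [ht.eventually h, ht1.eventually h] with n h1 h2
    exact mul_pos (by linarith) (by linarith)
  · filter_upwards [ht.eventually h, ht1.eventually h] with n h1 h2
    exact mul_pos_of_neg_of_neg (by linarith) (by linarith)

/-- Polynomial form of the normalized Meixner polynomials. -/
noncomputable def MP (a c : ℝ) (n : ℕ) : ℝ[X] :=
  ∑ j ∈ Finset.range (n + 1), C ((n.choose j : ℝ) * ((1 - a⁻¹) ^ j / poch c j)) *
    descPochhammer ℝ j

lemma MP_eval (a c : ℝ) (n : ℕ) (x : ℝ) : (MP a c n).eval x = MN a c n x := by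
  simp [MP, MN, eval_finsetSum, descPochhammer_eval_eq_prod_range, ffac]

lemma MP_natDegree (a c : ℝ) (n : ℕ) : (MP a c n).natDegree ≤ n := by
  refine Polynomial.natDegree_sum_le_of_forall_le _ _ fun j hj => ?_
  refine (natDegree_C_mul_le _ _).trans ?_
  rw [descPochhammer_natDegree]
  simpa [Nat.lt_succ_iff] using hj

lemma MP_coeff (a c : ℝ) (n : ℕ) : (MP a c n).coeff n = (1 - a⁻¹) ^ n / poch c n := by
  rw [MP, finsetSum_coeff, Finset.sum_range_succ, Finset.sum_eq_zero]
  · have h := monic_descPochhammer ℝ n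
    have h2 : (descPochhammer ℝ n).coeff n = 1 := by
      have := h.coeff_natDegree
      rwa [descPochhammer_natDegree] at this
    simp [h2]
  · intro j hj
    rw [coeff_C_mul, coeff_eq_zero_of_natDegree_lt, mul_zero]
    rw [descPochhammer_natDegree]; simpa using hj

/-- A real function given by a polynomial. -/
def IsPolyFun (f : ℝ → ℝ) : Prop := ∃ p : ℝ[X], ∀ x, f x = p.eval x

lemma IsPolyFun.meixner (a c : ℝ) (ha0 : a ≠ 0) (ha1 : a ≠ 1) (hc : ∀ n : ℕ, c ≠ -(n : ℝ))
    (n : ℕ) (t s : ℝ) : IsPolyFun (fun x => t * meixner a c n (x + s)) :=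
  ⟨C (t * gam a c n) * (MP a c n).comp (X + C s), fun x => by
    simp only [meixner_eq a c ha0 ha1 hc]; simp [MP_eval]; ring⟩

lemma IsPolyFun.det {k : ℕ} (g : Fin k → Fin k → ℝ → ℝ) (h : ∀ i j, IsPolyFun (g i j)) :
    IsPolyFun (fun x => Matrix.det (Matrix.of fun i j => g i j x)) := by
  choose p hp using h
  refine ⟨Matrix.det (Matrix.of p), fun x => ?_⟩
  rw [← coe_evalRingHom, RingHom.map_det]
  refine congrArg Matrix.det ?_
  ext i j
  simp [hp]

lemma OmegaM_poly (a c : ℝ) (ha0 : a ≠ 0) (ha1 : a ≠ 1) (hc : ∀ n : ℕ, c ≠ -(n : ℝ))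
    (F1 F2 : Finset ℕ) : IsPolyFun (OmegaM a c F1 F2) := by
  unfold OmegaM
  refine IsPolyFun.det _ fun i j => ?_
  by_cases h : (i : ℕ) < F1.card
  · simpa [h] using IsPolyFun.meixner a c ha0 ha1 hc _ 1 _
  · simpa [h] using IsPolyFun.meixner a⁻¹ c (inv_ne_zero ha0) (inv_ne_one' ha1) hc _ _ _

lemma mExc_poly (a c : ℝ) (ha0 : a ≠ 0) (ha1 : a ≠ 1) (hc : ∀ n : ℕ, c ≠ -(n : ℝ))
    (F1 F2 : Finset ℕ) (n : ℕ) : IsPolyFun (mExc a c F1 F2 n) := by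
  unfold mExc
  refine IsPolyFun.det _ fun i j => ?_
  by_cases h0 : (i : ℕ) = 0
  · simpa [h0] using IsPolyFun.meixner a c ha0 ha1 hc _ 1 _
  by_cases h : (i : ℕ) - 1 < F1.card
  · simpa [h, h0] using IsPolyFun.meixner a c ha0 ha1 hc _ 1 _
  · simpa [h, h0] using IsPolyFun.meixner a⁻¹ c (inv_ne_zero ha0) (inv_ne_one' ha1) hc _ _ _


/-! ### Part 3: Casorati determinants and the Darboux-Crum difference equation -/

noncomputable def muC {k : ℕ} (φ : Fin k → ℕ → ℝ) (x : ℕ) (j : Fin (k + 1)) : ℝ :=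
  Matrix.det (Matrix.of fun i l : Fin k => φ i (x + (j.succAbove l : ℕ)))

noncomputable def OmC {k : ℕ} (φ : Fin k → ℕ → ℝ) (x : ℕ) : ℝ :=
  Matrix.det (Matrix.of fun i l : Fin k => φ i (x + (l : ℕ)))

noncomputable def WC {k : ℕ} (φ : Fin k → ℕ → ℝ) (x : ℕ) : (ℕ → ℝ) →ₗ[ℝ] ℝ :=
  ∑ j : Fin (k + 1), ((-1) ^ (j : ℕ) * muC φ x j) • LinearMap.proj (x + (j : ℕ))

lemma WC_apply {k : ℕ} (φ : Fin k → ℕ → ℝ) (x : ℕ) (y : ℕ → ℝ) :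
    WC φ x y = ∑ j : Fin (k + 1), (-1) ^ (j : ℕ) * y (x + (j : ℕ)) * muC φ x j := by
  simp only [WC, LinearMap.sum_apply, LinearMap.smul_apply, LinearMap.proj_apply, smul_eq_mul]
  refine Finset.sum_congr rfl fun j _ => ?_
  ring

lemma muC_zero {k : ℕ} (φ : Fin k → ℕ → ℝ) (x : ℕ) : muC φ x 0 = OmC φ (x + 1) := by
  unfold muC OmC
  refine congrArg Matrix.det ?_
  ext i l
  simp only [Matrix.of_apply, Fin.succAbove_zero, Fin.val_succ]
  rw [add_assoc, add_comm 1]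

lemma muC_last {k : ℕ} (φ : Fin k → ℕ → ℝ) (x : ℕ) : muC φ x (Fin.last k) = OmC φ x := by
  unfold muC OmC
  refine congrArg Matrix.det ?_
  ext i l
  simp [Fin.succAbove_last]

lemma WC_eq_det {k : ℕ} (φ : Fin k → ℕ → ℝ) (x : ℕ) (y : ℕ → ℝ) :
    WC φ x y = Matrix.det (Matrix.of fun i j : Fin (k + 1) =>
      (Fin.cons y φ : Fin (k + 1) → ℕ → ℝ) i (x + (j : ℕ))) := by
  rw [Matrix.det_succ_row_zero, WC_apply]
  refine Finset.sum_congr rfl fun j _ => ?_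
  simp only [Matrix.of_apply, Fin.cons_zero]
  congr 1

lemma WC_self {k : ℕ} (φ : Fin k → ℕ → ℝ) (x : ℕ) (i : Fin k) : WC φ x (φ i) = 0 := by
  rw [WC_eq_det]
  apply Matrix.det_zero_of_row_eq (i := 0) (j := i.succ) (Fin.succ_ne_zero i).symm
  ext j
  simp

lemma window {k : ℕ} (φ : Fin k → ℕ → ℝ) (x : ℕ) (hΩ : OmC φ x ≠ 0) (ℓ : (ℕ → ℝ) →ₗ[ℝ] ℝ)
    (hw : ∀ y : ℕ → ℝ, (∀ j ≤ k, y (x + j) = 0) → ℓ y = 0) (hφ : ∀ i, ℓ (φ i) = 0) :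
    ∃ κ : ℝ, ∀ y, ℓ y = κ * WC φ x y := by
  have hWw : ∀ y : ℕ → ℝ, (∀ j ≤ k, y (x + j) = 0) → WC φ x y = 0 := by
    intro y hy
    rw [WC_apply]
    refine Finset.sum_eq_zero fun j _ => ?_
    rw [hy j (by omega)]; ring
  set δ : ℕ → ℝ := Pi.single (x + k) 1 with hδ
  have key : ∀ y : ℕ → ℝ, ∃ t : ℝ, ∀ L : (ℕ → ℝ) →ₗ[ℝ] ℝ,
      (∀ y : ℕ → ℝ, (∀ j ≤ k, y (x + j) = 0) → L y = 0) → (∀ i, L (φ i) = 0) →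
      L y = t * L δ := by
    intro y
    set A : Matrix (Fin k) (Fin k) ℝ := Matrix.of fun i l : Fin k => φ i (x + (l : ℕ)) with hA
    have hu : IsUnit A.det := by
      rw [isUnit_iff_ne_zero]; exact hΩ
    set v : Fin k → ℝ := fun l => y (x + (l : ℕ)) with hv
    set b : Fin k → ℝ := Matrix.vecMul v A⁻¹ with hb
    have hbA : Matrix.vecMul b A = v := by
      rw [hb, Matrix.vecMul_vecMul, Matrix.nonsing_inv_mul _ hu, Matrix.vecMul_one]
    set y' : ℕ → ℝ := y - ∑ i, b i • φ i with hy'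
    refine ⟨y' (x + k), fun L hL hLφ => ?_⟩
    have h1 : L y' = L y := by
      rw [hy', map_sub, map_sum]
      simp [hLφ]
    have h2 : L (y' - y' (x + k) • δ) = 0 := by
      apply hL
      intro j hj
      rcases hj.lt_or_eq with hj | rfl
      · have e1 : δ (x + j) = 0 := by
          rw [hδ, Pi.single_apply, if_neg (by omega)]
        have e2 : y' (x + j) = 0 := by
          have := congrFun hbA ⟨j, hj⟩
          simp only [Matrix.vecMul, dotProduct, hA, Matrix.of_apply, hv] at this
          simp [hy', this]
        simp [e1, e2]
      · simp [hδ]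
    rw [map_sub, map_smul, h1, smul_eq_mul, sub_eq_zero] at h2
    exact h2
  have hWδ : WC φ x δ = (-1) ^ k * OmC φ x := by
    rw [WC_apply, Finset.sum_eq_single (Fin.last k)]
    · simp [hδ, muC_last]
    · intro j _ hj
      have : (j : ℕ) ≠ k := fun h => hj (Fin.ext (by simpa using h))
      rw [hδ, Pi.single_apply, if_neg (by omega)]; ring
    · simp
  have hne : WC φ x δ ≠ 0 := by
    rw [hWδ]; exact mul_ne_zero (pow_ne_zero _ (by norm_num)) hΩ
  refine ⟨ℓ δ / WC φ x δ, fun y => ?_⟩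
  obtain ⟨t, ht⟩ := key y
  rw [ht ℓ hw hφ, ht (WC φ x) hWw (WC_self φ x)]
  field_simp

/-- A tridiagonal operator on sequences. -/
def TL (α β : ℕ → ℝ) : (ℕ → ℝ) →ₗ[ℝ] (ℕ → ℝ) where
  toFun y x := α x * y (x + 1) + β x * y x + x * y (x - 1)
  map_add' y z := by ext x; simp; ring
  map_smul' r y := by ext x; simp; ring

lemma TL_apply (α β : ℕ → ℝ) (y : ℕ → ℝ) (x : ℕ) :
    TL α β y x = α x * y (x + 1) + β x * y x + x * y (x - 1) := rfl

lemma crum {k : ℕ} (φ : Fin k → ℕ → ℝ) (α β : ℕ → ℝ) (lam : Fin k → ℝ)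
    (hφ : ∀ i, TL α β (φ i) = lam i • φ i) (x : ℕ) (h0 : OmC φ x ≠ 0) (h1 : OmC φ (x + 1) ≠ 0) :
    ∃ κ : ℝ, ∀ (y : ℕ → ℝ) (μ : ℝ), TL α β y = μ • y →
      μ * WC φ x y = α (x + k) * OmC φ x / OmC φ (x + 1) * WC φ (x + 1) y
        + x * OmC φ (x + 1) / OmC φ x * WC φ (x - 1) y - κ * WC φ x y := by
  set ℓ : (ℕ → ℝ) →ₗ[ℝ] ℝ := (α (x + k) * OmC φ x / OmC φ (x + 1)) • WC φ (x + 1)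
    + ((x : ℝ) * OmC φ (x + 1) / OmC φ x) • WC φ (x - 1) - (WC φ x).comp (TL α β) with hℓ
  have hap : ∀ y, ℓ y = α (x + k) * OmC φ x / OmC φ (x + 1) * WC φ (x + 1) y
        + x * OmC φ (x + 1) / OmC φ x * WC φ (x - 1) y - WC φ x (TL α β y) := by
    intro y; simp [hℓ]
  have hfin : (∃ κ : ℝ, ∀ y, ℓ y = κ * WC φ x y) → ∃ κ : ℝ, ∀ (y : ℕ → ℝ) (μ : ℝ),
      TL α β y = μ • y →
      μ * WC φ x y = α (x + k) * OmC φ x / OmC φ (x + 1) * WC φ (x + 1) y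
        + x * OmC φ (x + 1) / OmC φ x * WC φ (x - 1) y - κ * WC φ x y := by
    rintro ⟨κ, hκ⟩
    refine ⟨κ, fun y μ hy => ?_⟩
    have := hκ y
    rw [hap, hy, map_smul, smul_eq_mul] at this
    linarith
  refine hfin (window φ x h0 ℓ ?_ ?_)
  · intro y hy
    rw [hap]
    have e1 : WC φ (x + 1) y = (-1) ^ k * y (x + k + 1) * OmC φ (x + 1) := by
      rw [WC_apply, Finset.sum_eq_single (Fin.last k)]
      · rw [muC_last, Fin.val_last, show x + 1 + k = x + k + 1 by ring]
      · intro j _ hj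
        have : (j : ℕ) ≠ k := fun h => hj (Fin.ext (by simpa using h))
        rw [show x + 1 + (j : ℕ) = x + (j + 1) by ring, hy _ (by omega)]; ring
      · simp
    have e2 : (x : ℝ) * WC φ (x - 1) y = x * (y (x - 1) * OmC φ x) := by
      rcases x with _ | x
      · simp
      congr 1
      rw [Nat.add_sub_cancel, WC_apply, Finset.sum_eq_single 0]
      · rw [muC_zero]; simp
      · intro j _ hj
        have : (j : ℕ) ≠ 0 := fun h => hj (Fin.ext (by simpa using h))
        rw [show x + (j : ℕ) = x + 1 + (j - 1) by omega, hy _ (by omega)]; ring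
      · simp
    have e3 : WC φ x (TL α β y) = (-1) ^ k * (α (x + k) * y (x + k + 1)) * OmC φ x
        + x * y (x - 1) * OmC φ (x + 1) := by
      have s1 : ∑ j : Fin (k + 1), (-1) ^ (j : ℕ) * (α (x + j) * y (x + j + 1)) * muC φ x j =
          (-1) ^ k * (α (x + k) * y (x + k + 1)) * OmC φ x := by
        rw [Finset.sum_eq_single (Fin.last k)]
        · rw [muC_last, Fin.val_last]
        · intro j _ hj
          have : (j : ℕ) ≠ k := fun h => hj (Fin.ext (by simpa using h))
          rw [add_assoc, hy _ (by omega)]; ring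
        · simp
      have s2 : ∑ j : Fin (k + 1), (-1) ^ (j : ℕ) * (((x + j : ℕ) : ℝ) * y (x + j - 1)) * muC φ x j
          = x * y (x - 1) * OmC φ (x + 1) := by
        rw [Finset.sum_eq_single 0]
        · rw [muC_zero]; simp
        · intro j _ hj
          have : (j : ℕ) ≠ 0 := fun h => hj (Fin.ext (by simpa using h))
          rw [show x + (j : ℕ) - 1 = x + (j - 1) by omega, hy _ (by omega)]; ring
        · simp
      rw [← s1, ← s2, WC_apply, ← Finset.sum_add_distrib]
      refine Finset.sum_congr rfl fun j _ => ?_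
      rw [TL_apply, hy j (by omega)]; ring
    rw [e1, e3]
    have e4 : (x : ℝ) * OmC φ (x + 1) / OmC φ x * WC φ (x - 1) y =
        OmC φ (x + 1) / OmC φ x * (x * WC φ (x - 1) y) := by ring
    rw [e4, e2]
    field_simp
    ring
  · intro i
    rw [hap, hφ, map_smul, WC_self, WC_self, WC_self]; simp

lemma telescope {k : ℕ} (φ : Fin k → ℕ → ℝ) (α β : ℕ → ℝ) (lam : Fin k → ℝ)
    (hφ : ∀ i, TL α β (φ i) = lam i • φ i) (hΩ : ∀ x, OmC φ x ≠ 0) (v : ℕ → ℝ)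
    (hv : ∀ x : ℕ, v (x + 1) * (x + 1) * OmC φ (x + 2) = α (x + k) * v x * OmC φ x)
    (y1 y2 : ℕ → ℝ) (μ1 μ2 : ℝ) (h1 : TL α β y1 = μ1 • y1) (h2 : TL α β y2 = μ2 • y2) (N : ℕ) :
    (μ1 - μ2) * ∑ x ∈ Finset.range N, WC φ x y1 * WC φ x y2 * v x =
      - (v N * N * OmC φ (N + 1) / OmC φ N *
        (WC φ (N - 1) y1 * WC φ N y2 - WC φ N y1 * WC φ (N - 1) y2)) := by
  induction N with
  | zero => simp
  | succ N ih =>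
    rw [Finset.sum_range_succ, mul_add, ih]
    obtain ⟨κ, hκ⟩ := crum φ α β lam hφ N (hΩ N) (hΩ (N + 1))
    have a1 := hκ y1 μ1 h1
    have a2 := hκ y2 μ2 h2
    have e : v (N + 1) * ((N + 1 : ℕ) : ℝ) * OmC φ (N + 1 + 1) / OmC φ (N + 1) =
        α (N + k) * OmC φ N / OmC φ (N + 1) * v N := by
      push_cast
      rw [hv N]; ring
    rw [e, Nat.add_sub_cancel]
    linear_combination a1 * (WC φ N y2 * v N) - a2 * (WC φ N y1 * v N)


/-! ### Part 4: orthogonality, and negativity for negative `a` -/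

noncomputable def phiM (a c : ℝ) (F1 F2 : Finset ℕ) (i : Fin (F1.card + F2.card)) (x : ℕ) : ℝ :=
  if (i : ℕ) < F1.card then meixner a c (nth F1 (i : ℕ)) (x : ℝ)
  else a ^ (-(x : ℤ)) * meixner a⁻¹ c (nth F2 ((i : ℕ) - F1.card)) (x : ℝ)

noncomputable def sF (a : ℝ) (F1 F2 : Finset ℕ) : ℝ :=
  ∏ i : Fin (F1.card + F2.card), if (i : ℕ) < F1.card then 1 else a

lemma sF_ne (a : ℝ) (ha0 : a ≠ 0) (F1 F2 : Finset ℕ) : sF a F1 F2 ≠ 0 := by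
  rw [sF, Finset.prod_ne_zero_iff]
  intro i _
  split_ifs <;> simp [ha0]

lemma sF_pos (a : ℝ) (ha0 : 0 < a) (F1 F2 : Finset ℕ) : 0 < sF a F1 F2 := by
  rw [sF]
  refine Finset.prod_pos fun i _ => ?_
  split_ifs <;> simp [ha0]

lemma phi_scale (a c : ℝ) (ha0 : a ≠ 0) (F1 F2 : Finset ℕ) (i : Fin (F1.card + F2.card))
    (x j : ℕ) : (if (i : ℕ) < F1.card then meixner a c (nth F1 (i : ℕ)) ((x : ℝ) + (j : ℝ))
    else a ^ (-(j : ℤ)) * meixner a⁻¹ c (nth F2 ((i : ℕ) - F1.card)) ((x : ℝ) + (j : ℝ))) =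
    (if (i : ℕ) < F1.card then 1 else a) ^ x * phiM a c F1 F2 i (x + j) := by
  unfold phiM
  by_cases h : (i : ℕ) < F1.card
  · simp [h]
  · simp only [h, if_false]
    rw [← mul_assoc]
    push_cast
    congr 1
    rw [← zpow_natCast, ← zpow_add₀ ha0]
    congr 1
    ring

lemma Omega_eq (a c : ℝ) (ha0 : a ≠ 0) (F1 F2 : Finset ℕ) (x : ℕ) :
    OmegaM a c F1 F2 (x : ℝ) = sF a F1 F2 ^ x * OmC (phiM a c F1 F2) x := by
  rw [OmegaM, OmC, sF, ← Finset.prod_pow, ← Matrix.det_mul_column]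
  refine congrArg Matrix.det ?_
  ext i j
  simp only [Matrix.of_apply]
  rw [phi_scale a c ha0]

lemma mExc_eq (a c : ℝ) (ha0 : a ≠ 0) (F1 F2 : Finset ℕ) (n x : ℕ) :
    mExc a c F1 F2 n (x : ℝ) = sF a F1 F2 ^ x *
      WC (phiM a c F1 F2) x (fun x => meixner a c (n - uF F1 F2) (x : ℝ)) := by
  rw [mExc, Matrix.det_succ_row_zero, WC_apply, Finset.mul_sum]
  refine Finset.sum_congr rfl fun j _ => ?_
  have : Matrix.det (Matrix.submatrix (Matrix.of fun i j : Fin (F1.card + F2.card + 1) =>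
    if (i : ℕ) = 0 then meixner a c (n - uF F1 F2) ((x : ℝ) + ((j : ℕ) : ℝ))
    else if (i : ℕ) - 1 < F1.card then meixner a c (nth F1 ((i : ℕ) - 1)) ((x : ℝ) + ((j : ℕ) : ℝ))
    else a ^ (-((j : ℕ) : ℤ)) *
      meixner a⁻¹ c (nth F2 ((i : ℕ) - 1 - F1.card)) ((x : ℝ) + ((j : ℕ) : ℝ))) Fin.succ j.succAbove) =
      sF a F1 F2 ^ x * muC (phiM a c F1 F2) x j := by
    rw [muC, sF, ← Finset.prod_pow, ← Matrix.det_mul_column]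
    refine congrArg Matrix.det ?_
    ext i l
    simp only [Matrix.of_apply, Matrix.submatrix_apply, Fin.val_succ, Nat.add_sub_cancel,
      Nat.add_one_ne_zero, if_false]
    rw [phi_scale a c ha0]
  rw [this]
  simp only [Matrix.of_apply, Fin.val_zero, if_true]
  push_cast
  ring

lemma eig_m (a c : ℝ) (ha0 : a ≠ 0) (ha1 : a ≠ 1) (hc : ∀ n : ℕ, c ≠ -(n : ℝ)) (n : ℕ) :
    TL (fun x => a * (x + c)) (fun x => -(x + a * (x + c))) (fun x => meixner a c n (x : ℝ)) =
      ((a - 1) * n) • (fun x : ℕ => meixner a c n (x : ℝ)) := by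
  ext x
  rw [TL_apply]
  have h := meixner_diff a c ha0 ha1 hc n x
  simp only [Pi.smul_apply, smul_eq_mul]
  rw [← h]
  rcases x with _ | x
  · simp; ring
  · rw [Nat.add_sub_cancel]; push_cast; rw [add_sub_cancel_right]; ring

lemma eig_psi (a c : ℝ) (ha0 : a ≠ 0) (ha1 : a ≠ 1) (hc : ∀ n : ℕ, c ≠ -(n : ℝ)) (n : ℕ) :
    TL (fun x => a * (x + c)) (fun x => -(x + a * (x + c)))
      (fun x => a ^ (-(x : ℤ)) * meixner a⁻¹ c n (x : ℝ)) =
      ((1 - a) * (n + c)) • (fun x : ℕ => a ^ (-(x : ℤ)) * meixner a⁻¹ c n (x : ℝ)) := by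
  ext x
  rw [TL_apply]
  have h := meixner_diff a⁻¹ c (inv_ne_zero ha0) (inv_ne_one' ha1) hc n x
  simp only [Pi.smul_apply, smul_eq_mul]
  have h' : (x + c) * meixner a⁻¹ c n (x + 1) - (a * x + (x + c)) * meixner a⁻¹ c n x
      + a * x * meixner a⁻¹ c n (x - 1) = (1 - a) * n * meixner a⁻¹ c n x := by
    have e : a * a⁻¹ = 1 := mul_inv_cancel₀ ha0
    linear_combination a * h - (x + c) * meixner a⁻¹ c n (x + 1) * e + (x + c) * meixner a⁻¹ c n x * e
      + n * meixner a⁻¹ c n x * e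
  have z1 : a * a ^ (-((x + 1 : ℕ) : ℤ)) = a ^ (-(x : ℤ)) := by
    rw [mul_comm, ← zpow_add_one₀ ha0]; congr 1; push_cast; ring
  have z2 : (x : ℝ) * (a ^ (-((x - 1 : ℕ) : ℤ)) * meixner a⁻¹ c n ((x - 1 : ℕ) : ℝ)) =
      a ^ (-(x : ℤ)) * (a * x * meixner a⁻¹ c n (x - 1)) := by
    rcases x with _ | x
    · simp
    · rw [Nat.add_sub_cancel, ← mul_assoc (a ^ _), ← mul_assoc (a ^ _), ← zpow_add_one₀ ha0]
      push_cast
      rw [add_sub_cancel_right, show -((x : ℤ) + 1) + 1 = -x by ring]; ring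
  rw [z2]
  push_cast at z1 ⊢
  linear_combination a ^ (-(x : ℤ)) * h' + (x + c) * meixner a⁻¹ c n (x + 1) * z1

lemma eig_phi (a c : ℝ) (ha0 : a ≠ 0) (ha1 : a ≠ 1) (hc : ∀ n : ℕ, c ≠ -(n : ℝ))
    (F1 F2 : Finset ℕ) : ∃ lam : Fin (F1.card + F2.card) → ℝ, ∀ i,
    TL (fun x => a * (x + c)) (fun x => -(x + a * (x + c))) (phiM a c F1 F2 i) =
      lam i • phiM a c F1 F2 i := by
  refine ⟨fun i => if (i : ℕ) < F1.card then (a - 1) * nth F1 i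
    else (1 - a) * (nth F2 ((i : ℕ) - F1.card) + c), fun i => ?_⟩
  by_cases h : (i : ℕ) < F1.card
  · have : phiM a c F1 F2 i = fun x : ℕ => meixner a c (nth F1 (i : ℕ)) (x : ℝ) := by
      ext x; simp [phiM, h]
    rw [this, eig_m a c ha0 ha1 hc]; simp [h]
  · have : phiM a c F1 F2 i =
        fun x : ℕ => a ^ (-(x : ℤ)) * meixner a⁻¹ c (nth F2 ((i : ℕ) - F1.card)) (x : ℝ) := by
      ext x; simp only [phiM, h, if_false]
    rw [this, eig_psi a c ha0 ha1 hc]; simp only [h, if_false]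

lemma gshift_ne (c : ℝ) (hc : ∀ n : ℕ, c ≠ -(n : ℝ)) (k x : ℕ) : (x : ℝ) + (c + k) ≠ 0 := by
  intro h; apply hc (x + k); push_cast; linarith

lemma part_i (a c : ℝ) (ha0 : a ≠ 0) (ham : -1 < a) (ha1 : a < 1)
    (hc : ∀ n : ℕ, c ≠ -(n : ℝ)) (F1 F2 : Finset ℕ)
    (hΩ : ∀ n : ℕ, OmegaM a c F1 F2 (n : ℝ) ≠ 0) (n m : ℕ) (hn : n ∈ sigmaF F1 F2)
    (hm : m ∈ sigmaF F1 F2) (hnm : n ≠ m) :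
      Summable (fun x : ℕ =>
        |mExc a c F1 F2 n (x : ℝ) * mExc a c F1 F2 m (x : ℝ) * wM a c F1 F2 x|) ∧
      ∑' x : ℕ, mExc a c F1 F2 n (x : ℝ) * mExc a c F1 F2 m (x : ℝ) * wM a c F1 F2 x = 0 := by
  have ha1' : a ≠ 1 := ha1.ne
  have habs : |a| < 1 := abs_lt.mpr ⟨ham, ha1⟩
  set k := F1.card + F2.card with hk
  obtain ⟨pO, hpO⟩ := OmegaM_poly a c ha0 ha1' hc F1 F2
  obtain ⟨pn, hpn⟩ := mExc_poly a c ha0 ha1' hc F1 F2 n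
  obtain ⟨pm, hpm⟩ := mExc_poly a c ha0 ha1' hc F1 F2 m
  set G : ℕ → ℝ := fun x => Real.Gamma ((x : ℝ) + (c + k)) / (x.factorial : ℝ) with hG
  have hGP : PB G := PB.gamma (c + k) (gshift_ne c hc k)
  have hI : PB (fun x : ℕ => (pO.eval (x : ℝ))⁻¹) :=
    PB.inv_poly pO fun n => by rw [← hpO]; exact hΩ n
  have hI1 : PB (fun x : ℕ => (pO.eval ((x : ℝ) + 1))⁻¹) := by
    have := PB.inv_poly (pO.comp (X + C 1)) fun n => by
      have := hΩ (n + 1)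
      rw [hpO] at this
      simpa using this
    simpa using this
  have hfun : (fun x : ℕ => mExc a c F1 F2 n (x : ℝ) * mExc a c F1 F2 m (x : ℝ) * wM a c F1 F2 x)
      = fun x : ℕ => a ^ x * (pn.eval (x : ℝ) * pm.eval (x : ℝ) *
        (G x * ((pO.eval (x : ℝ))⁻¹ * (pO.eval ((x : ℝ) + 1))⁻¹))) := by
    ext x
    rw [wM, hpn, hpm, hpO, hpO, ← hk]
    simp only [hG]
    rw [← add_assoc]
    field_simp
  have hsum : Summable (fun x : ℕ =>
        |mExc a c F1 F2 n (x : ℝ) * mExc a c F1 F2 m (x : ℝ) * wM a c F1 F2 x|) := by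
    have := (((PB.poly pn).mul (PB.poly pm)).mul (hGP.mul (hI.mul hI1))).summable ha0 habs
    have h2 := congrArg (fun f : ℕ → ℝ => fun x => |f x|) hfun
    exact (show (fun x : ℕ => |mExc a c F1 F2 n (x : ℝ) * mExc a c F1 F2 m (x : ℝ) * wM a c F1 F2 x|) = _ from h2) ▸ this
  refine ⟨hsum, ?_⟩
  have hs := hsum.of_abs.hasSum.tendsto_sum_nat
  refine tendsto_nhds_unique hs ?_
  -- telescoping
  set s := sF a F1 F2 with hs
  have hs0 : s ≠ 0 := sF_ne a ha0 F1 F2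
  set φ := phiM a c F1 F2 with hφ
  have hOm : ∀ x : ℕ, OmC φ x ≠ 0 := by
    intro x h
    apply hΩ x
    rw [Omega_eq a c ha0, ← hφ, h, mul_zero]
  obtain ⟨lam, hlam⟩ := eig_phi a c ha0 ha1' hc F1 F2
  set v : ℕ → ℝ := fun x => a ^ x * G x / (OmC φ x * OmC φ (x + 1)) with hv
  have hvrec : ∀ x : ℕ, v (x + 1) * (x + 1) * OmC φ (x + 2) =
      (fun x : ℕ => a * ((x : ℝ) + c)) (x + k) * v x * OmC φ x := by
    intro x
    have h0 := hOm x
    have h1 := hOm (x + 1)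
    have h2 := hOm (x + 2)
    have g1 : G (x + 1) * (x + 1) = G x * (x + (c + k)) := by
      simp only [hG]
      rw [show (((x + 1 : ℕ) : ℝ) + (c + k)) = (x + (c + k)) + 1 by push_cast; ring,
        Real.Gamma_add_one (gshift_ne c hc k x), Nat.factorial_succ]
      push_cast
      field_simp
    simp only [hv]
    rw [show x + 1 + 1 = x + 2 by ring]
    push_cast
    field_simp
    rw [pow_succ]
    linear_combination a ^ x * a * g1
  have hdiff : ((a - 1) * ((n - uF F1 F2 : ℕ) : ℝ)) - (a - 1) * ((m - uF F1 F2 : ℕ) : ℝ) ≠ 0 := by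
    rw [← mul_sub]
    refine mul_ne_zero (sub_ne_zero.mpr ha1') (sub_ne_zero.mpr ?_)
    have h1 := hn.1
    have h2 := hm.1
    intro h
    have := Nat.cast_injective h
    omega
  have htel := telescope φ _ _ lam hlam hOm v hvrec _ _ _ _
    (eig_m a c ha0 ha1' hc (n - uF F1 F2)) (eig_m a c ha0 ha1' hc (m - uF F1 F2))
  set W1 : ℕ → ℝ := fun x => WC φ x (fun x => meixner a c (n - uF F1 F2) (x : ℝ)) with hW1
  set W2 : ℕ → ℝ := fun x => WC φ x (fun x => meixner a c (m - uF F1 F2) (x : ℝ)) with hW2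
  have E1 : ∀ x : ℕ, pn.eval (x : ℝ) = s ^ x * W1 x := fun x => by
    rw [← hpn, mExc_eq a c ha0]
  have E2 : ∀ x : ℕ, pm.eval (x : ℝ) = s ^ x * W2 x := fun x => by
    rw [← hpm, mExc_eq a c ha0]
  have EO : ∀ x : ℕ, pO.eval (x : ℝ) = s ^ x * OmC φ x := fun x => by
    rw [← hpO, Omega_eq a c ha0]
  have hterm : ∀ x : ℕ, mExc a c F1 F2 n (x : ℝ) * mExc a c F1 F2 m (x : ℝ) * wM a c F1 F2 x =
      s⁻¹ * (W1 x * W2 x * v x) := by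
    intro x
    have h0 := hOm x
    have h1 := hOm (x + 1)
    have eo1 := EO (x + 1)
    push_cast at eo1
    rw [congrFun hfun x, E1, E2, EO, eo1]
    simp only [hv]
    rw [pow_succ]
    field_simp
  set f : ℕ → ℝ := fun x => s * (x : ℝ) * G x * ((pO.eval (x : ℝ))⁻¹ * (pO.eval (x : ℝ))⁻¹) *
    ((pn.comp (X - C 1)).eval (x : ℝ) * pm.eval (x : ℝ)
      - pn.eval (x : ℝ) * (pm.comp (X - C 1)).eval (x : ℝ)) with hf
  have hfP : PB f := by
    refine PB.mul (((PB.const s).mul PB.cast).mul hGP |>.mul (hI.mul hI)) ?_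
    exact ((PB.poly _).mul (PB.poly _)).sub ((PB.poly _).mul (PB.poly _))
  have hgf : ∀ N : ℕ, v N * N * OmC φ (N + 1) / OmC φ N *
        (W1 (N - 1) * W2 N - W1 N * W2 (N - 1)) = a ^ N * f N := by
    intro N
    rcases N with _ | x
    · simp [hf]
    have h1 := hOm (x + 1)
    have h2 := hOm (x + 1 + 1)
    simp only [hf, hv, eval_comp, eval_sub, eval_X, eval_C]
    rw [E1, E2, EO]
    have e1 := E1 x
    have e2 := E2 x
    push_cast
    rw [add_sub_cancel_right, e1, e2, pow_succ s]
    field_simp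
  have hlim := hfP.tendsto ha0 habs
  have hfin : ∀ N : ℕ, ∑ x ∈ Finset.range N,
      mExc a c F1 F2 n (x : ℝ) * mExc a c F1 F2 m (x : ℝ) * wM a c F1 F2 x =
      (-(s⁻¹ * ((a - 1) * ((n - uF F1 F2 : ℕ) : ℝ) - (a - 1) * ((m - uF F1 F2 : ℕ) : ℝ))⁻¹)) *
        (a ^ N * f N) := by
    intro N
    have := htel N
    rw [hgf N] at this
    rw [Finset.sum_congr rfl (fun x _ => hterm x), ← Finset.mul_sum]
    generalize ((a - 1) * ((n - uF F1 F2 : ℕ) : ℝ) - (a - 1) * ((m - uF F1 F2 : ℕ) : ℝ)) = d at *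
    rw [← neg_eq_iff_eq_neg] at this
    rw [← this]
    field_simp
    rfl
  simp only [hfin]
  simpa using hlim.const_mul
    (-(s⁻¹ * ((a - 1) * ((n - uF F1 F2 : ℕ) : ℝ) - (a - 1) * ((m - uF F1 F2 : ℕ) : ℝ))⁻¹))

lemma part_ii (a c : ℝ) (ha0 : a ≠ 0) (ha1 : a ≠ 1)
    (hc : ∀ n : ℕ, c ≠ -(n : ℝ)) (F1 F2 : Finset ℕ)
    (hΩ : ∀ n : ℕ, OmegaM a c F1 F2 (n : ℝ) ≠ 0) (hneg : a < 0) :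
    ∃ x : ℕ, wM a c F1 F2 x < 0 := by
  obtain ⟨pO, hpO⟩ := OmegaM_poly a c ha0 ha1 hc F1 F2
  have hp0 : pO ≠ 0 := by
    rintro rfl; apply hΩ 0; rw [hpO]; simp
  have h1 := poly_consec pO hp0
  have h2 : ∀ᶠ n : ℕ in Filter.atTop, 0 < (n : ℝ) + c + ((F1.card + F2.card : ℕ) : ℝ) := by
    have ht := tendsto_natCast_atTop_atTop (R := ℝ)
    filter_upwards [ht.eventually_gt_atTop (-c - ((F1.card + F2.card : ℕ) : ℝ))] with n hn
    linarith
  obtain ⟨N, hN⟩ := Filter.eventually_atTop.mp (h1.and h2)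
  refine ⟨2 * N + 1, ?_⟩
  obtain ⟨h3, h4⟩ := hN (2 * N + 1) (by omega)
  rw [wM, hpO, hpO, mul_assoc (Nat.factorial _ : ℝ)]
  apply div_neg_of_neg_of_pos
  · refine mul_neg_of_neg_of_pos ?_ (Real.Gamma_pos_of_pos h4)
    exact Odd.pow_neg ⟨N, rfl⟩ hneg
  · exact mul_pos (by positivity) h3


/-! ### Part 5: the Meixner functional -/

noncomputable def rho (a c : ℝ) (x : ℕ) : ℝ := a ^ x * (poch c x / (x.factorial : ℝ))

lemma rho_summable {a : ℝ} (ha0 : 0 < a) (ha1 : a < 1) (c : ℝ) {f : ℕ → ℝ} (hf : PB f) :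
    Summable (fun x => f x * rho a c x) := by
  have := (hf.mul (PB.poch c)).summable' ha0.ne' (by rw [abs_of_pos ha0]; exact ha1)
  refine this.congr fun x => ?_
  simp only [rho]; ring

lemma rho_summable1 {a : ℝ} (ha0 : 0 < a) (ha1 : a < 1) (c : ℝ) : Summable (rho a c) := by
  have := rho_summable ha0 ha1 c (PB.const 1)
  simpa using this

noncomputable def SS (a c : ℝ) : ℝ := ∑' x, rho a c x

lemma poch_succ' (c : ℝ) (n : ℕ) : poch c (n + 1) = c * poch (c + 1) n := by
  have := poch_add c 1 n
  rw [add_comm n 1, this]; simp [poch]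

lemma rho_zero (a c : ℝ) : rho a c 0 = 1 := by simp [rho, poch]

lemma SS_step {a : ℝ} (ha0 : 0 < a) (ha1 : a < 1) (c : ℝ) : SS a c = (1 - a) * SS a (c + 1) := by
  have h1 := (rho_summable1 ha0 ha1 c)
  have h2 := (rho_summable1 ha0 ha1 (c + 1))
  have e1 := h1.tsum_eq_zero_add
  have e2 := h2.tsum_eq_zero_add
  have h3 := (summable_nat_add_iff 1).mpr h2
  have e3 : ∑' x, rho a c (x + 1) = ∑' x, rho a (c + 1) (x + 1) - a * ∑' x, rho a (c + 1) x := by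
    rw [← tsum_mul_left, ← h3.tsum_sub (h2.mul_left a)]
    refine tsum_congr fun x => ?_
    simp only [rho]
    rw [poch_succ', poch_succ, Nat.factorial_succ]
    push_cast
    field_simp
    ring
  simp only [SS]
  rw [rho_zero] at e1 e2
  linarith

lemma SS_add {a : ℝ} (ha0 : 0 < a) (ha1 : a < 1) (c : ℝ) (m : ℕ) :
    SS a (c + m) = SS a c / (1 - a) ^ m := by
  induction m with
  | zero => simp
  | succ m ih =>
    have := SS_step ha0 ha1 (c + m)
    have h : 1 - a ≠ 0 := by linarith
    push_cast
    rw [← add_assoc, pow_succ, eq_div_iff (by positivity)]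
    rw [ih, div_eq_iff (by positivity)] at this
    linarith

lemma poch_pos {c : ℝ} (hc : 0 < c) (n : ℕ) : 0 < poch c n :=
  Finset.prod_pos fun i _ => by positivity

lemma SS_pos {a : ℝ} (ha0 : 0 < a) (ha1 : a < 1) (c : ℝ) : 0 < SS a c := by
  obtain ⟨m, hm⟩ := exists_nat_gt (-c)
  have h := SS_add ha0 ha1 c m
  have h' : (0 : ℝ) < 1 - a := by linarith
  have hp : 0 < SS a (c + m) := by
    refine (rho_summable1 ha0 ha1 _).tsum_pos (fun x => ?_) 0 (by rw [rho_zero]; norm_num)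
    have := poch_pos (c := c + m) (by linarith) x
    unfold rho; positivity
  rw [h] at hp
  have := (div_pos_iff_of_pos_right (show 0 < (1 - a) ^ m by positivity)).mp hp
  exact this

lemma PB.ffac (j : ℕ) : PB (fun x => ffac (x : ℝ) j) := by
  have := PB.poly (descPochhammer ℝ j)
  simpa [descPochhammer_eval_eq_prod_range, _root_.ffac] using this

lemma ffac_moment {a : ℝ} (ha0 : 0 < a) (ha1 : a < 1) (d : ℝ) (j : ℕ) :
    ∑' x : ℕ, ffac (x : ℝ) j * rho a d x = a ^ j * poch d j * SS a (d + j) := by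
  induction j generalizing d with
  | zero => simp [ffac, poch, SS]
  | succ j ih =>
    rw [(rho_summable ha0 ha1 d (PB.ffac (j + 1))).tsum_eq_zero_add]
    have : ∀ x : ℕ, ffac ((x + 1 : ℕ) : ℝ) (j + 1) * rho a d (x + 1) =
        a * d * (ffac (x : ℝ) j * rho a (d + 1) x) := by
      intro x
      rw [ffac_succ']
      simp only [rho]
      rw [poch_succ', Nat.factorial_succ]
      push_cast
      rw [add_sub_cancel_right, pow_succ]
      field_simp
    simp only [this]
    rw [tsum_mul_left, ih, ffac_succ', poch_succ']
    push_cast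
    rw [show d + 1 + (j : ℝ) = d + (j + 1) by ring]
    simp
    ring

lemma poch_rho (a c : ℝ) (m x : ℕ) :
    poch ((x : ℝ) + c) m * rho a c x = poch c m * rho a (c + m) x := by
  have h1 := poch_add c x m
  have h2 := poch_add c m x
  rw [add_comm m x, h1] at h2
  simp only [rho]
  rw [add_comm (x : ℝ) c]
  linear_combination a ^ x / (x.factorial : ℝ) * h2

lemma mixed_moment {a : ℝ} (ha0 : 0 < a) (ha1 : a < 1) (c : ℝ) (j m : ℕ) :
    ∑' x : ℕ, ffac (x : ℝ) j * poch ((x : ℝ) + c) m * rho a c x =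
      a ^ j * poch c (j + m) * SS a c / (1 - a) ^ (j + m) := by
  have : ∀ x : ℕ, ffac (x : ℝ) j * poch ((x : ℝ) + c) m * rho a c x =
      poch c m * (ffac (x : ℝ) j * rho a (c + m) x) := by
    intro x
    rw [mul_assoc, poch_rho]; ring
  simp only [this]
  rw [tsum_mul_left, ffac_moment ha0 ha1, add_comm j m, poch_add c m j, add_assoc, ← Nat.cast_add,
    SS_add ha0 ha1]
  ring

/-- The Pochhammer polynomial. -/
noncomputable def pochP (c : ℝ) (m : ℕ) : ℝ[X] := ∏ i ∈ Finset.range m, (X + C (c + i))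

lemma pochP_eval (c x : ℝ) (m : ℕ) : (pochP c m).eval x = poch (x + c) m := by
  simp [pochP, poch, eval_prod, add_assoc]

lemma pochP_monic (c : ℝ) (m : ℕ) : (pochP c m).Monic :=
  monic_prod_of_monic _ _ fun _ _ => monic_X_add_C _

lemma pochP_natDegree (c : ℝ) (m : ℕ) : (pochP c m).natDegree = m := by
  rw [pochP, natDegree_prod_of_monic _ _ fun i _ => monic_X_add_C _]
  simp only [natDegree_X_add_C]
  simp

/-- Functional attached to a weight. -/
noncomputable def Lam (v : ℕ → ℝ) (h : ∀ p : ℝ[X], Summable fun x : ℕ => p.eval (x : ℝ) * v x) :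
    ℝ[X] →ₗ[ℝ] ℝ where
  toFun p := ∑' x : ℕ, p.eval (x : ℝ) * v x
  map_add' p q := by
    simp only [eval_add, add_mul]
    exact (h p).tsum_add (h q)
  map_smul' r p := by
    simp only [eval_smul, smul_eq_mul, RingHom.id_apply, mul_assoc]
    exact tsum_mul_left

lemma Lam_apply (v : ℕ → ℝ) (h) (p : ℝ[X]) : Lam v h p = ∑' x : ℕ, p.eval (x : ℝ) * v x := rfl

lemma alt_sum (p : ℝ[X]) (n : ℕ) (hp : p.natDegree ≤ n) :
    ∑ j ∈ Finset.range (n + 1), (n.choose j : ℝ) * (-1) ^ j * p.eval (j : ℝ) =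
      p.coeff n * ((-1) ^ n * n.factorial) := by
  have h := fwdDiff_iter_eq_sum_shift (1 : ℝ) (fun t : ℝ => p.eval t) n 0
  have h2 : (fwdDiff (1 : ℝ))^[n] (fun t : ℝ => p.eval t) 0 = p.coeff n * n.factorial := by
    rcases hp.lt_or_eq with hlt | heq
    · have := Polynomial.fwdDiff_iter_eq_zero_of_degree_lt hlt
      rw [coeff_eq_zero_of_natDegree_lt hlt]
      have := congrFun this 0
      simpa using this
    · have := congrFun (Polynomial.fwdDiff_iter_degree_eq_factorial p) 0
      rw [heq] at this
      rw [this]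
      simp [leadingCoeff, heq]
  rw [h2] at h
  rw [← mul_assoc, mul_comm _ ((-1 : ℝ) ^ n), mul_assoc, h, Finset.mul_sum]
  refine Finset.sum_congr rfl fun j hj => ?_
  have hj' : j ≤ n := by simpa [Nat.lt_succ_iff] using hj
  simp only [zero_add, nsmul_eq_mul, mul_one, zsmul_eq_mul]
  push_cast
  have : (-1 : ℝ) ^ n * (-1) ^ (n - j) = (-1) ^ j := by
    obtain ⟨d, rfl⟩ := Nat.exists_eq_add_of_le hj'
    rw [Nat.add_sub_cancel_left, pow_add, mul_assoc, ← mul_pow]; simp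
  rw [← this]; ring

section
variable {a c : ℝ} (ha0 : 0 < a) (ha1 : a < 1) (hc : ∀ n : ℕ, c ≠ -(n : ℝ))

noncomputable def Lr : ℝ[X] →ₗ[ℝ] ℝ := Lam (rho a c) fun p => rho_summable ha0 ha1 c (PB.poly p)

noncomputable def etaM (a c : ℝ) (n : ℕ) : ℝ := SS a c / (1 - a) ^ n * ((-1) ^ n * n.factorial)

lemma Lr_pochP (hc : ∀ n : ℕ, c ≠ -(n : ℝ)) (n m : ℕ) (hm : m ≤ n) :
    Lr (c := c) ha0 ha1 (MP a c n * pochP c m) = (if m = n then 1 else 0) * etaM a c n := by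
  have hs : ∀ j, Lr (c := c) ha0 ha1 (descPochhammer ℝ j * pochP c m) =
      a ^ j * poch c (j + m) * SS a c / (1 - a) ^ (j + m) := by
    intro j
    rw [← mixed_moment ha0 ha1, Lr, Lam_apply]
    refine tsum_congr fun x => ?_
    rw [eval_mul, pochP_eval, descPochhammer_eval_eq_prod_range, ffac]
  have h1 : 1 - a ≠ 0 := by linarith
  rw [MP, Finset.sum_mul, map_sum]
  have : ∀ j ∈ Finset.range (n + 1), Lr (c := c) ha0 ha1
      (C ((n.choose j : ℝ) * ((1 - a⁻¹) ^ j / poch c j)) * descPochhammer ℝ j * pochP c m) =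
      SS a c / (1 - a) ^ m * ((n.choose j : ℝ) * (-1) ^ j * (pochP c m).eval (j : ℝ)) := by
    intro j _
    rw [mul_assoc, ← smul_eq_C_mul, map_smul, hs, pochP_eval, poch_add, smul_eq_mul,
      add_comm (j : ℝ) c]
    have hp := poch_ne c hc j
    have e : (1 - a⁻¹) * a = -1 * (1 - a) := by field_simp; ring
    have e' : (1 - a⁻¹) ^ j * a ^ j = (-1) ^ j * (1 - a) ^ j := by
      rw [← mul_pow, e, mul_pow]
    generalize 1 - a⁻¹ = u at e'
    rw [pow_add]
    field_simp
    linear_combination (n.choose j : ℝ) * poch (c + j) m * SS a c * e'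
  rw [Finset.sum_congr rfl this, ← Finset.mul_sum, alt_sum _ _ (by rw [pochP_natDegree]; exact hm)]
  rcases hm.lt_or_eq with hlt | heq
  · rw [coeff_eq_zero_of_natDegree_lt (by rw [pochP_natDegree]; exact hlt)]
    simp [hlt.ne]
  · subst heq
    have := (pochP_monic c m).coeff_natDegree
    rw [pochP_natDegree] at this
    rw [this, etaM]; simp

lemma Lr_MP (hc : ∀ n : ℕ, c ≠ -(n : ℝ)) (n : ℕ) (p : ℝ[X]) (hp : p.natDegree ≤ n) :
    Lr (c := c) ha0 ha1 (MP a c n * p) = p.coeff n * etaM a c n := by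
  have key : ∀ m : ℕ, m ≤ n → ∀ p : ℝ[X], p.natDegree ≤ m →
      Lr (c := c) ha0 ha1 (MP a c n * p) = p.coeff n * etaM a c n := by
    intro m
    induction m with
    | zero =>
      intro hm p hp
      have h0 := Lr_pochP ha0 ha1 hc n 0 hm
      rw [eq_C_of_natDegree_le_zero hp, mul_comm, ← smul_eq_C_mul, map_smul]
      simp only [pochP, Finset.range_zero, Finset.prod_empty, mul_one] at h0
      rw [h0, coeff_C]
      by_cases hn : n = 0
      · simp [hn]
      · simp [hn, Ne.symm hn]
    | succ m ih =>
      intro hm p hp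
      set r := p - C (p.coeff (m + 1)) * pochP c (m + 1) with hr
      have hrd : r.natDegree ≤ m := by
        rw [natDegree_le_iff_coeff_eq_zero]
        intro N hN
        have hmon := (pochP_monic c (m + 1)).coeff_natDegree
        rw [pochP_natDegree] at hmon
        rcases (show m + 1 ≤ N from hN).lt_or_eq with h | h
        · rw [hr, coeff_sub, coeff_C_mul, coeff_eq_zero_of_natDegree_lt (lt_of_le_of_lt hp h),
            coeff_eq_zero_of_natDegree_lt (p := pochP c (m + 1)) (by rw [pochP_natDegree]; exact h)]
          simp
        · rw [hr, coeff_sub, coeff_C_mul, ← h, hmon]; simp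
      have e : p = r + (p.coeff (m + 1)) • pochP c (m + 1) := by rw [hr, smul_eq_C_mul]; ring
      have h1 := ih (by omega) r hrd
      have h2 := Lr_pochP ha0 ha1 hc n (m + 1) hm
      have e2 : MP a c n * p = MP a c n * r + (p.coeff (m + 1)) • (MP a c n * pochP c (m + 1)) := by
        conv_lhs => rw [e]
        rw [mul_add, mul_smul_comm]
      have hr0 : r.coeff n = 0 := coeff_eq_zero_of_natDegree_lt (lt_of_le_of_lt hrd hm)
      rw [e2, map_add, map_smul, h1, h2, hr0]
      by_cases hn : m + 1 = n
      · simp [hn]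
      · have hp0 : p.coeff n = 0 := coeff_eq_zero_of_natDegree_lt (lt_of_le_of_lt hp (by omega))
        simp [hn, hp0]
  exact key n le_rfl p hp

lemma Lr_MP_MP (hc : ∀ n : ℕ, c ≠ -(n : ℝ)) (n m : ℕ) :
    Lr (c := c) ha0 ha1 (MP a c n * MP a c m) = if n = m then SS a c / rho a c n else 0 := by
  have key : ∀ n m : ℕ, m ≤ n → Lr (c := c) ha0 ha1 (MP a c n * MP a c m) =
      if n = m then SS a c / rho a c n else 0 := by
    intro n m h
    rw [Lr_MP ha0 ha1 hc n _ ((MP_natDegree a c m).trans h)]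
    rcases h.lt_or_eq with hlt | heq
    · rw [coeff_eq_zero_of_natDegree_lt (lt_of_le_of_lt (MP_natDegree a c m) hlt)]
      simp [hlt.ne']
    · subst heq
      rw [MP_coeff, if_pos rfl, etaM, rho]
      have hp := poch_ne c hc m
      have h1 : 1 - a ≠ 0 := by linarith
      have e : (1 - a⁻¹) * a = -1 * (1 - a) := by field_simp; ring
      have e' : (1 - a⁻¹) ^ m * a ^ m = (-1) ^ m * (1 - a) ^ m := by
        rw [← mul_pow, e, mul_pow]
      have e3 : (-1 : ℝ) ^ m * (-1) ^ m = 1 := by rw [← mul_pow]; simp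
      generalize 1 - a⁻¹ = u at e'
      field_simp
      linear_combination (-1) ^ m * SS a c * e' + SS a c * (1 - a) ^ m * e3
  rcases le_total m n with h | h
  · exact key n m h
  · rw [mul_comm, key m n h]
    by_cases e : n = m
    · simp [e]
    · simp [e, Ne.symm e]
end


/-! ### Part 6: Christoffel transform and positivity -/

section
variable {a c : ℝ} (ha0 : 0 < a) (ha1 : a < 1)

noncomputable def phiZ (a c : ℝ) {k : ℕ} (z : Fin k → ℝ) (i : Fin k) (n : ℕ) : ℝ := MN a c n (z i)

noncomputable def PZ {k : ℕ} (z : Fin k → ℝ) : ℝ[X] := ∏ i, (X - C (z i))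

lemma PZ_monic {k : ℕ} (z : Fin k → ℝ) : (PZ z).Monic :=
  monic_prod_of_monic _ _ fun _ _ => monic_X_sub_C _

lemma PZ_natDegree {k : ℕ} (z : Fin k → ℝ) : (PZ z).natDegree = k := by
  rw [PZ, natDegree_prod_of_monic _ _ fun _ _ => monic_X_sub_C _]
  simp only [natDegree_X_sub_C]
  simp

lemma christoffel (hc : ∀ n : ℕ, c ≠ -(n : ℝ)) {k : ℕ} (z : Fin k → ℝ)
    (hz : Function.Injective z) (n : ℕ) :
    ∃ q : ℝ[X], q.natDegree ≤ n ∧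
      q.coeff n = (-1) ^ k * OmC (phiZ a c z) n * ((1 - a⁻¹) ^ (n + k) / poch c (n + k)) ∧
      ∀ p : ℝ[X], p.natDegree ≤ n →
        Lr (c := c) ha0 ha1 (PZ z * (q * p)) = p.coeff n * OmC (phiZ a c z) (n + 1) * etaM a c n := by
  set φ := phiZ a c z with hφ
  set Q : ℝ[X] := ∑ j : Fin (k + 1), C ((-1) ^ (j : ℕ) * muC φ n j) * MP a c (n + j) with hQ
  have hQe : ∀ i, Q.eval (z i) = 0 := by
    intro i
    have := WC_self φ n i
    rw [WC_apply] at this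
    rw [hQ, eval_finsetSum, ← this]
    refine Finset.sum_congr rfl fun j _ => ?_
    rw [eval_C_mul, MP_eval]
    simp only [hφ, phiZ]
    ring
  have hdvd : PZ z ∣ Q := by
    refine Finset.prod_dvd_of_coprime ?_ fun i _ => dvd_iff_isRoot.mpr (hQe i)
    intro i _ j _ hij
    exact pairwise_coprime_X_sub_C hz hij
  obtain ⟨q, hq⟩ := hdvd
  have hQd : Q.natDegree ≤ n + k := by
    refine natDegree_sum_le_of_forall_le _ _ fun j _ => ?_
    refine (natDegree_C_mul_le _ _).trans ((MP_natDegree a c _).trans ?_)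
    have := j.2
    omega
  have hqd : q.natDegree ≤ n := by
    have : (PZ z * q).natDegree ≤ n + k := hq ▸ hQd
    by_cases h0 : q = 0
    · simp [h0]
    · rw [(PZ_monic z).natDegree_mul' h0, PZ_natDegree] at this
      omega
  refine ⟨q, hqd, ?_, ?_⟩
  · have h1 : Q.coeff (n + k) = q.coeff n := by
      rw [hq, add_comm n k, coeff_mul_add_eq_of_natDegree_le (PZ_natDegree z).le hqd]
      have := (PZ_monic z).coeff_natDegree
      rw [PZ_natDegree] at this
      rw [this, one_mul]
    rw [← h1, hQ, finsetSum_coeff, Fin.sum_univ_castSucc, Finset.sum_eq_zero, zero_add, coeff_C_mul]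
    · rw [Fin.val_last, MP_coeff, muC_last]
    · intro j _
      rw [coeff_C_mul, coeff_eq_zero_of_natDegree_lt, mul_zero]
      refine lt_of_le_of_lt (MP_natDegree a c _) ?_
      simp
  · intro p hp
    rw [← mul_assoc, ← hq, hQ, Finset.sum_mul, map_sum, Fin.sum_univ_succ, Finset.sum_eq_zero, add_zero]
    · rw [mul_assoc, ← smul_eq_C_mul, map_smul]
      simp only [Fin.val_zero, add_zero, muC_zero]
      rw [Lr_MP ha0 ha1 hc n p hp, smul_eq_mul]; ring
    · intro j _
      rw [mul_assoc, ← smul_eq_C_mul, map_smul, Lr_MP ha0 ha1 hc _ p (hp.trans (by omega)),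
        coeff_eq_zero_of_natDegree_lt (lt_of_le_of_lt hp (by simp))]
      simp

lemma density (ha0 : 0 < a) (ha1 : a < 1) (d : ℝ) (hd : 0 < d) (τ : ℕ → ℝ) (K : ℝ) (hτ : ∀ x, |τ x| ≤ K * rho a d x)
    (hpos : ∀ p : ℝ[X], 0 ≤ ∑' x : ℕ, p.eval (x : ℝ) ^ 2 * τ x) (x0 : ℕ) : 0 ≤ τ x0 := by
  have hdn : ∀ n : ℕ, d ≠ -(n : ℝ) := fun n h => by
    have := Nat.cast_nonneg (α := ℝ) n
    linarith
  have hr : ∀ x, 0 < rho a d x := fun x => by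
    have := poch_pos hd x
    unfold rho; positivity
  have hS := SS_pos ha0 ha1 d
  set L := Lr (c := d) ha0 ha1 with hL
  set A : ℕ → ℝ := fun N => ∑ n ∈ Finset.range N, MN a d x0 n * MN a d x0 n * rho a d n / SS a d
    with hA
  have hAlim : Filter.Tendsto A Filter.atTop (nhds (rho a d x0)⁻¹) := by
    have h1 := Lr_MP_MP ha0 ha1 hdn x0 x0
    rw [if_pos rfl] at h1
    have h2 : HasSum (fun n : ℕ => MN a d x0 n * MN a d x0 n * rho a d n) (SS a d / rho a d x0) := by
      rw [← h1, Lr, Lam_apply]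
      have := (rho_summable ha0 ha1 d (PB.poly (MP a d x0 * MP a d x0))).hasSum
      simpa [MP_eval] using this
    have h3 := (h2.div_const (SS a d)).tendsto_sum_nat
    have e : SS a d / rho a d x0 / SS a d = (rho a d x0)⁻¹ := by
      have := (hr x0).ne'
      field_simp
    rw [e] at h3
    exact h3
  set p : ℕ → ℝ[X] := fun N => ∑ n ∈ Finset.range N,
    (rho a d x0 * (MN a d x0 n * rho a d n / SS a d)) • MP a d n with hp
  have hpx : ∀ N, (p N).eval (x0 : ℝ) = rho a d x0 * A N := by
    intro N
    simp only [hp, hA, eval_finsetSum, eval_smul, MP_eval, smul_eq_mul, Finset.mul_sum]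
    refine Finset.sum_congr rfl fun n _ => ?_
    rw [MN_symm a d n x0]; ring
  have hpp : ∀ N, L (p N * p N) = rho a d x0 ^ 2 * A N := by
    intro N
    have h1 : ∀ n ∈ Finset.range N, L (MP a d n * p N) = rho a d x0 * MN a d x0 n := by
      intro n hn
      simp only [hp, Finset.mul_sum, map_sum, mul_smul_comm, map_smul, hL, Lr_MP_MP ha0 ha1 hdn,
        smul_eq_mul, mul_ite, mul_zero]
      rw [Finset.sum_ite_eq, if_pos hn]
      have := (hr n).ne'
      field_simp
    have h2 : p N * p N = ∑ n ∈ Finset.range N,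
        (rho a d x0 * (MN a d x0 n * rho a d n / SS a d)) • (MP a d n * p N) := by
      conv_lhs => rw [hp]
      simp only [Finset.sum_mul, smul_mul_assoc]
      rfl
    rw [h2, map_sum]
    simp only [hA, Finset.mul_sum]
    refine Finset.sum_congr rfl fun n hn => ?_
    rw [map_smul, h1 n hn, smul_eq_mul]; ring
  set D : ℕ → ℝ := fun x => if x = x0 then 1 else 0 with hD
  have hsq : ∀ N, HasSum (fun x : ℕ => ((p N).eval (x : ℝ) - D x) ^ 2 * rho a d x)
      (rho a d x0 - rho a d x0 ^ 2 * A N) := by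
    intro N
    have h1 := (rho_summable ha0 ha1 d (PB.poly (p N * p N))).hasSum
    have h2 := hasSum_ite_eq x0 ((2 * (p N).eval (x0 : ℝ) - 1) * rho a d x0)
    have h3 := h1.sub h2
    have e : ∑' x : ℕ, (p N * p N).eval (x : ℝ) * rho a d x = rho a d x0 ^ 2 * A N := hpp N
    rw [e, hpx] at h3
    rw [show rho a d x0 - rho a d x0 ^ 2 * A N =
      rho a d x0 ^ 2 * A N - (2 * (rho a d x0 * A N) - 1) * rho a d x0 by ring]
    refine h3.congr_fun fun x => ?_
    by_cases hx : x = x0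
    · subst hx; simp only [hD, if_true, eval_mul]; rw [hpx]; ring
    · simp only [hD, hx, if_false, eval_mul]; ring
  have hsτ : ∀ f : ℕ → ℝ, Summable (fun x => f x * rho a d x) → (∀ x, 0 ≤ f x) →
      Summable (fun x => f x * τ x) := by
    intro f hf hf0
    refine Summable.of_norm_bounded (hf.mul_left K) fun x => ?_
    rw [Real.norm_eq_abs, abs_mul, abs_of_nonneg (hf0 x)]
    have := mul_le_mul_of_nonneg_left (hτ x) (hf0 x)
    linarith
  have hbound : ∀ N, 0 ≤ K * (rho a d x0 - rho a d x0 ^ 2 * A N)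
      + (2 * (rho a d x0 * A N) - 1) * τ x0 := by
    intro N
    have s1 := hsτ _ (hsq N).summable (fun x => sq_nonneg _)
    have h2 := hasSum_ite_eq x0 ((2 * (p N).eval (x0 : ℝ) - 1) * τ x0)
    have h3 := s1.hasSum.add h2
    have e : (fun x : ℕ => (p N).eval (x : ℝ) ^ 2 * τ x) = fun x : ℕ =>
        ((p N).eval (x : ℝ) - D x) ^ 2 * τ x +
          if x = x0 then (2 * (p N).eval (x0 : ℝ) - 1) * τ x0 else 0 := by
      ext x
      by_cases hx : x = x0
      · subst hx; simp only [hD, if_true]; ring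
      · simp only [hD, hx, if_false]; ring
    have h4 := hpos (p N)
    rw [e, h3.tsum_eq, hpx] at h4
    have h5 : ∑' x : ℕ, ((p N).eval (x : ℝ) - D x) ^ 2 * τ x ≤
        K * (rho a d x0 - rho a d x0 ^ 2 * A N) := by
      have h6 := (hsq N).mul_left K
      rw [← h6.tsum_eq]
      refine s1.tsum_le_tsum (fun x => ?_) h6.summable
      have := mul_le_mul_of_nonneg_left ((le_abs_self _).trans (hτ x))
        (sq_nonneg ((p N).eval (x : ℝ) - D x))
      linarith
    linarith
  have hlim : Filter.Tendsto (fun N => K * (rho a d x0 - rho a d x0 ^ 2 * A N)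
      + (2 * (rho a d x0 * A N) - 1) * τ x0) Filter.atTop (nhds
      (K * (rho a d x0 - rho a d x0 ^ 2 * (rho a d x0)⁻¹)
      + (2 * (rho a d x0 * (rho a d x0)⁻¹) - 1) * τ x0)) := by
    refine Filter.Tendsto.add ?_ ?_
    · exact ((hAlim.const_mul _).const_sub _).const_mul _
    · exact (((hAlim.const_mul _).const_mul _).sub_const _).mul_const _
  have e : K * (rho a d x0 - rho a d x0 ^ 2 * (rho a d x0)⁻¹)
      + (2 * (rho a d x0 * (rho a d x0)⁻¹) - 1) * τ x0 = τ x0 := by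
    have := (hr x0).ne'
    field_simp; ring
  rw [e] at hlim
  exact ge_of_tendsto' hlim hbound

lemma poch_one (n : ℕ) : poch 1 n = n.factorial := by
  induction n with
  | zero => simp [poch]
  | succ n ih => rw [poch_succ, ih, Nat.factorial_succ]; push_cast; ring

lemma PB.dominated {f : ℕ → ℝ} (hf : PB f) (ha0 : 0 < a) :
    ∃ d : ℝ, 0 < d ∧ ∃ K : ℝ, ∀ x, |a ^ x * f x| ≤ K * rho a d x := by
  obtain ⟨C, M, hC, h⟩ := hf
  refine ⟨1 + M, by positivity, C * M.factorial, fun x => ?_⟩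
  have h1 : ((x : ℝ) + 1) ^ M ≤ _root_.poch (1 + x) M := by
    rw [← Finset.card_range M, ← Finset.prod_const, Finset.card_range, _root_.poch]
    refine Finset.prod_le_prod (fun i _ => by positivity) fun i _ => ?_
    have := Nat.cast_nonneg (α := ℝ) i
    linarith
  have h2 := poch_add 1 x M
  have h3 := poch_add 1 M x
  rw [add_comm M x, h2, poch_one, poch_one] at h3
  have h4 : _root_.poch (1 + x) M = M.factorial * (_root_.poch (1 + M) x / x.factorial) := by
    field_simp; linarith
  rw [abs_mul, abs_of_pos (pow_pos ha0 x), rho]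
  calc a ^ x * |f x| ≤ a ^ x * (C * ((x : ℝ) + 1) ^ M) := by gcongr; exact h x
    _ ≤ a ^ x * (C * _root_.poch (1 + x) M) := by gcongr
    _ = _ := by rw [h4]; ring

lemma positivity_iff (ha0 : 0 < a) (ha1 : a < 1) (hc : ∀ n : ℕ, c ≠ -(n : ℝ)) {k : ℕ} (z : Fin k → ℝ)
    (hz : Function.Injective z) (hΩ : ∀ n, OmC (phiZ a c z) n ≠ 0) (g : ℝ) (hg : g ≠ 0) :
    (∀ n : ℕ, 0 < g * poch c (n + k) * (OmC (phiZ a c z) n * OmC (phiZ a c z) (n + 1))) ↔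
    ∀ x : ℕ, 0 ≤ g * (PZ z).eval (x : ℝ) * rho a c x := by
  choose q hq1 hq2 hq3 using christoffel ha0 ha1 hc z hz
  set φ := phiZ a c z with hφ
  set L := Lr (c := c) ha0 ha1 with hL
  have hS := SS_pos ha0 ha1 c
  have h1a : 0 < 1 - a := by linarith
  have hb : 0 < a⁻¹ - 1 := by
    have := (one_lt_inv₀ ha0).mpr ha1
    linarith
  have hs : ∀ n, ∃ t > 0, L (PZ z * (q n * q n)) =
      t * (poch c (n + k) * (OmC φ n * OmC φ (n + 1))) := by
    intro n
    have hp := poch_ne c hc (n + k)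
    refine ⟨(a⁻¹ - 1) ^ (n + k) / poch c (n + k) ^ 2 * (SS a c / (1 - a) ^ n * n.factorial),
      by positivity, ?_⟩
    rw [hq3 n _ (hq1 n), hq2, etaM]
    have e : (1 - a⁻¹) ^ (n + k) = (-1) ^ (n + k) * (a⁻¹ - 1) ^ (n + k) := by
      rw [← mul_pow]; congr 1; ring
    have e3 : (-1 : ℝ) ^ (n + k) * ((-1) ^ n * (-1) ^ k) = 1 := by
      rw [← pow_add, ← mul_pow]; simp
    rw [e]
    generalize a⁻¹ - 1 = u
    field_simp
    linear_combination OmC φ n * u ^ (n + k) * OmC φ (n + 1) * e3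
  have hτ : ∀ p : ℝ[X], g * L (PZ z * (p * p)) =
      ∑' x : ℕ, p.eval (x : ℝ) ^ 2 * (g * (PZ z).eval (x : ℝ) * rho a c x) := by
    intro p
    rw [hL, Lr, Lam_apply, ← tsum_mul_left]
    refine tsum_congr fun x => ?_
    simp only [eval_mul]; ring
  constructor
  · intro hw
    have hpos : ∀ n : ℕ, ∀ p : ℝ[X], p.degree < n → 0 ≤ g * L (PZ z * (p * p)) := by
      intro n
      induction n with
      | zero =>
        intro p hp
        have : p = 0 := by
          rw [← degree_eq_bot]
          exact Nat.WithBot.lt_zero_iff.mp hp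
        simp [this]
      | succ n ih =>
        intro p hp
        have hpn : p.natDegree ≤ n := by
          rw [natDegree_le_iff_coeff_eq_zero]
          intro N hN
          exact (degree_lt_iff_coeff_zero p (n + 1)).mp hp N hN
        have hqn : (q n).coeff n ≠ 0 := by
          rw [hq2]
          have := poch_ne c hc (n + k)
          have h2 := hΩ n
          have h3 : (1 - a⁻¹) ≠ 0 := by intro h; linarith
          positivity
        set t := p.coeff n / (q n).coeff n with ht
        set r := p - t • q n with hr
        have hrn : r.coeff n = 0 := by
          rw [hr, coeff_sub, coeff_smul, smul_eq_mul, ht]; field_simp; ring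
        have hrd : r.natDegree ≤ n :=
          natDegree_sub_le_of_le hpn ((natDegree_smul_le _ _).trans (hq1 n)) |>.trans (by simp)
        have hrlt : r.degree < n := by
          rw [degree_lt_iff_coeff_zero]
          intro m hm
          rcases hm.lt_or_eq with h | h
          · exact coeff_eq_zero_of_natDegree_lt (lt_of_le_of_lt hrd h)
          · rw [← h, hrn]
        have e : PZ z * (p * p) = PZ z * (r * r) + (2 * t) • (PZ z * (q n * r))
            + (t ^ 2) • (PZ z * (q n * q n)) := by
          have : p = r + t • q n := by rw [hr]; ring
          rw [this]
          simp only [smul_eq_C_mul, C_mul, C_pow]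
          have : (C 2 : ℝ[X]) = 2 := rfl
          rw [this]
          ring
        rw [e, map_add, map_add, map_smul, map_smul, hq3 n r hrd, hrn]
        obtain ⟨s, hs0, hs1⟩ := hs n
        rw [hs1]
        have h1 := ih r hrlt
        have h2 := hw n
        have h3 : 0 ≤ t ^ 2 * s * (g * poch c (n + k) * (OmC φ n * OmC φ (n + 1))) := by positivity
        simp only [smul_eq_mul]
        linarith
    have hPB : PB (fun x : ℕ => g * (PZ z).eval (x : ℝ) * (poch c x / (x.factorial : ℝ))) :=
      ((PB.const g).mul (PB.poly (PZ z))).mul (PB.poch c)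
    obtain ⟨d, hd, K, hK⟩ := hPB.dominated ha0
    intro x0
    refine density ha0 ha1 d hd (fun x : ℕ => g * (PZ z).eval (x : ℝ) * rho a c x) K (fun x => ?_) (fun p => ?_) x0
    · refine le_trans (le_of_eq ?_) (hK x)
      congr 1; simp only [rho]; ring
    · rw [← hτ]
      refine hpos (p.natDegree + 1) p ?_
      exact lt_of_le_of_lt degree_le_natDegree (by exact_mod_cast Nat.lt_succ_self _)
  · intro hx n
    obtain ⟨s, hs0, hs1⟩ := hs n
    have h1 : 0 ≤ g * L (PZ z * (q n * q n)) := by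
      rw [hτ]
      exact tsum_nonneg fun x => mul_nonneg (sq_nonneg _) (hx x)
    rw [hs1] at h1
    have h2 : 0 ≤ g * poch c (n + k) * (OmC φ n * OmC φ (n + 1)) := by
      by_contra h
      push Not at h
      nlinarith
    refine lt_of_le_of_ne h2 (Ne.symm ?_)
    have := poch_ne c hc (n + k)
    have h3 := hΩ n
    have h4 := hΩ (n + 1)
    positivity
end


/-! ### Part 7: positivity of the weight -/

lemma nth_eq (F : Finset ℕ) (i : Fin F.card) : nth F (i : ℕ) = F.orderEmbOfFin rfl i := by
  rw [Finset.orderEmbOfFin_apply, nth]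
  have : (i : ℕ) < (F.sort (· ≤ ·)).length := by simp
  rw [List.getD_eq_getElem _ _ this]
  rfl

lemma nth_prod (F : Finset ℕ) (g : ℕ → ℝ) : ∏ i : Fin F.card, g (nth F (i : ℕ)) = ∏ f ∈ F, g f := by
  rw [← Finset.prod_coe_sort F g, ← (F.orderIsoOfFin rfl).toEquiv.prod_comp]
  refine Finset.prod_congr rfl fun i _ => ?_
  rw [nth_eq]; rfl

lemma nth_inj (F : Finset ℕ) (i j : ℕ) (hi : i < F.card) (hj : j < F.card) (h : nth F i = nth F j) :
    i = j := by
  have h1 := nth_eq F ⟨i, hi⟩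
  have h2 := nth_eq F ⟨j, hj⟩
  simp only at h1 h2
  rw [h1, h2] at h
  have := (F.orderEmbOfFin rfl).injective h
  exact congrArg Fin.val this

noncomputable def zF (c : ℝ) (F1 F2 : Finset ℕ) (i : Fin (F1.card + F2.card)) : ℝ :=
  if (i : ℕ) < F1.card then (nth F1 i : ℝ) else -c - nth F2 ((i : ℕ) - F1.card)

lemma zF_inj (c : ℝ) (hc : ∀ n : ℕ, c ≠ -(n : ℝ)) (F1 F2 : Finset ℕ) :
    Function.Injective (zF c F1 F2) := by
  intro i j h
  simp only [zF] at h
  have hi := i.2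
  have hj := j.2
  apply Fin.ext
  by_cases h1 : (i : ℕ) < F1.card <;> by_cases h2 : (j : ℕ) < F1.card
  · simp only [h1, h2, if_true] at h
    exact nth_inj F1 _ _ h1 h2 (by exact_mod_cast h)
  · simp only [h1, h2, if_true, if_false] at h
    exfalso
    apply hc (nth F1 i + nth F2 ((j : ℕ) - F1.card)); push_cast; linarith
  · simp only [h1, h2, if_true, if_false] at h
    exfalso
    apply hc (nth F1 j + nth F2 ((i : ℕ) - F1.card)); push_cast; linarith
  · simp only [h1, h2, if_false] at h
    have h3 : (nth F2 ((i : ℕ) - F1.card) : ℝ) = nth F2 ((j : ℕ) - F1.card) := by linarith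
    have := nth_inj F2 _ _ (by omega) (by omega) (Nat.cast_injective h3)
    omega

lemma PZ_zF (c x : ℝ) (F1 F2 : Finset ℕ) : (PZ (zF c F1 F2)).eval x =
    (∏ f ∈ F1, (x - f)) * (∏ f ∈ F2, (x + c + f)) := by
  rw [PZ, eval_prod, Fin.prod_univ_add]
  rw [← nth_prod F1 (fun f => x - f), ← nth_prod F2 (fun f => x + c + f)]
  congr 1
  · refine Finset.prod_congr rfl fun i _ => ?_
    simp [zF]
  · refine Finset.prod_congr rfl fun i _ => ?_
    simp [zF]; ring

lemma phiM_dual (a c : ℝ) (ha0 : a ≠ 0) (ha1 : a ≠ 1) (hc : ∀ n : ℕ, c ≠ -(n : ℝ))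
    (F1 F2 : Finset ℕ) : ∃ K : ℝ, K ≠ 0 ∧
      ∀ x, OmC (phiM a c F1 F2) x = K * OmC (phiZ a c (zF c F1 F2)) x := by
  set κ : Fin (F1.card + F2.card) → ℝ := fun i =>
    if (i : ℕ) < F1.card then gam a c (nth F1 i) else gam a⁻¹ c (nth F2 ((i : ℕ) - F1.card)) with hκ
  refine ⟨∏ i, κ i, ?_, fun x => ?_⟩
  · rw [Finset.prod_ne_zero_iff]
    intro i _
    simp only [hκ]
    split_ifs
    · exact gam_ne a c ha0 ha1 hc _
    · exact gam_ne a⁻¹ c (inv_ne_zero ha0) (inv_ne_one' ha1) hc _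
  · rw [OmC, OmC, ← Matrix.det_mul_column]
    refine congrArg Matrix.det ?_
    ext i l
    simp only [Matrix.of_apply, phiM, phiZ, zF, hκ]
    generalize x + (l : ℕ) = y
    split_ifs
    · rw [meixner_eq a c ha0 ha1 hc, MN_symm]
    · rw [meixner_inv_dual a c ha0 ha1 hc, zpow_neg, zpow_natCast]
      have := pow_ne_zero y ha0
      field_simp

lemma Gamma_poch (c : ℝ) (hc : ∀ n : ℕ, c ≠ -(n : ℝ)) (n : ℕ) :
    Real.Gamma (c + n) = Real.Gamma c * poch c n := by
  induction n with
  | zero => simp [poch]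
  | succ n ih =>
    push_cast
    rw [← add_assoc, Real.Gamma_add_one (by intro h; apply hc n; linarith), ih, poch_succ]; ring

lemma admissible_iff (a c : ℝ) (ha0 : 0 < a) (hc : ∀ n : ℕ, c ≠ -(n : ℝ)) (F1 F2 : Finset ℕ) :
    IsAdmissible c F1 F2 ↔
      ∀ x : ℕ, 0 ≤ Real.Gamma c * (PZ (zF c F1 F2)).eval (x : ℝ) * rho a c x := by
  refine forall_congr' fun x => ?_
  rw [← PZ_zF]
  have hcc : 0 < c + chat c := by
    have h1 : -⌊c⌋ ≤ ((-⌊c⌋).toNat : ℤ) := Int.self_le_toNat _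
    have h2 : -(⌊c⌋ : ℝ) ≤ (chat c : ℝ) := by unfold chat; exact_mod_cast h1
    have h3 := Int.floor_le c
    refine lt_of_le_of_ne (by linarith) ?_
    intro h
    exact hc (chat c) (by linarith)
  have hG : 0 < Real.Gamma (c + (x + chat c : ℕ)) := by
    apply Real.Gamma_pos_of_pos
    push_cast
    have := Nat.cast_nonneg (α := ℝ) x
    linarith
  rw [Gamma_poch c hc, poch_add] at hG
  set T := (PZ (zF c F1 F2)).eval (x : ℝ)
  rw [rho, add_comm (x : ℝ) c]
  have hne : poch (c + x) (chat c) ≠ 0 := by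
    intro h; rw [h] at hG; simp at hG
  have e : Real.Gamma c * T * (a ^ x * (poch c x / x.factorial)) =
      (a ^ x / x.factorial * (Real.Gamma c * (poch c x * poch (c + x) (chat c)))) *
        (T / poch (c + x) (chat c)) := by
    field_simp
  rw [e]
  have hpos : 0 < a ^ x / x.factorial * (Real.Gamma c * (poch c x * poch (c + x) (chat c))) := by
    have : (0 : ℝ) < x.factorial := by positivity
    exact mul_pos (by positivity) hG
  exact (mul_nonneg_iff_of_pos_left hpos).symm

lemma part_iii (a c : ℝ) (ha0 : 0 < a) (ha1 : a < 1)
    (hc : ∀ n : ℕ, c ≠ -(n : ℝ)) (F1 F2 : Finset ℕ)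
    (hΩ : ∀ n : ℕ, OmegaM a c F1 F2 (n : ℝ) ≠ 0) :
    (∀ x : ℕ, 0 < wM a c F1 F2 x) ↔ IsAdmissible c F1 F2 := by
  obtain ⟨K, hK0, hK⟩ := phiM_dual a c ha0.ne' ha1.ne hc F1 F2
  have hs := sF_pos a ha0 F1 F2
  have hO : ∀ x : ℕ, OmegaM a c F1 F2 (x : ℝ) =
      sF a F1 F2 ^ x * (K * OmC (phiZ a c (zF c F1 F2)) x) := fun x => by
    rw [Omega_eq a c ha0.ne', hK]
  have hz : ∀ n, OmC (phiZ a c (zF c F1 F2)) n ≠ 0 := by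
    intro n h
    apply hΩ n
    rw [hO, h]; simp
  have hg : Real.Gamma c ≠ 0 := Real.Gamma_ne_zero hc
  rw [admissible_iff a c ha0 hc, ← positivity_iff ha0 ha1 hc _ (zF_inj c hc F1 F2) hz _ hg]
  refine forall_congr' fun x => ?_
  have h1 := hO (x + 1)
  push_cast at h1
  have h0 := hz x
  have h2 := hz (x + 1)
  rw [wM, h1, hO, show (x : ℝ) + c + ((F1.card + F2.card : ℕ) : ℝ) =
    c + ((x + (F1.card + F2.card) : ℕ) : ℝ) by push_cast; ring, Gamma_poch c hc]
  set O0 := OmC (phiZ a c (zF c F1 F2)) x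
  set O1 := OmC (phiZ a c (zF c F1 F2)) (x + 1)
  set s := sF a F1 F2
  have e : a ^ x * (Real.Gamma c * poch c (x + (F1.card + F2.card))) /
      (x.factorial * (s ^ x * (K * O0)) * (s ^ (x + 1) * (K * O1))) =
      (a ^ x / (x.factorial * (s ^ x * s ^ (x + 1)) * (K * O0 * O1) ^ 2)) *
        (Real.Gamma c * poch c (x + (F1.card + F2.card)) * (O0 * O1)) := by
    field_simp
  rw [e]
  refine mul_pos_iff_of_pos_left ?_
  positivity

/-- Theorem 4.4: for `-1 < a < 1`, `a ≠ 0`, `c ∉ {0, -1, -2, …}` and a pair `𝓕` with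
`Ω_𝓕^{a,c}(n) ≠ 0` for all `n ∈ ℕ`:
(i) the polynomials `m_n^{a,c;𝓕}`, `n ∈ σ_𝓕`, are orthogonal with respect to the (possibly
signed) discrete measure with masses `w(x)`, the defining series being absolutely convergent;
(ii) if `-1 < a < 0` the measure is never positive;
(iii) if `0 < a < 1` the measure is positive iff `c` and `𝓕` are admissible. -/
theorem meixner_exceptional_orthogonality (a c : ℝ) (ha0 : a ≠ 0) (ham : -1 < a) (ha1 : a < 1)
    (hc : ∀ n : ℕ, c ≠ -(n : ℝ))
    (F1 F2 : Finset ℕ) (hF1 : ∀ f ∈ F1, 0 < f) (hF2 : ∀ f ∈ F2, 0 < f)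
    (hne : F1.Nonempty ∨ F2.Nonempty)
    (hΩ : ∀ n : ℕ, OmegaM a c F1 F2 (n : ℝ) ≠ 0) :
    (∀ n ∈ sigmaF F1 F2, ∀ m ∈ sigmaF F1 F2, n ≠ m →
      Summable (fun x : ℕ =>
        |mExc a c F1 F2 n (x : ℝ) * mExc a c F1 F2 m (x : ℝ) * wM a c F1 F2 x|) ∧
      ∑' x : ℕ, mExc a c F1 F2 n (x : ℝ) * mExc a c F1 F2 m (x : ℝ) * wM a c F1 F2 x = 0) ∧
    (a < 0 → ∃ x : ℕ, wM a c F1 F2 x < 0) ∧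
    (0 < a → ((∀ x : ℕ, 0 < wM a c F1 F2 x) ↔ IsAdmissible c F1 F2)) := by
  exact ⟨fun n hn m hm hnm => part_i a c ha0 ham ha1 hc F1 F2 hΩ n m hn hm hnm,
    fun hneg => part_ii a c ha0 ha1.ne hc F1 F2 hΩ hneg,
    fun hpos => part_iii a c hpos ha1 hc F1 F2 hΩ⟩
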